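/- arXiv:2404.15167 — 3 statements merged into one kernel-verified Lean document; each statement's English description precedes it below -/
import Mathlib

section
/- Let L and U be real constants with 0 < L < U < 1. Then for every integer n ≥ 2/(1 − U) and every finite simple graph G on n vertices such that every vertex degree lies in the interval [Ln, Un], we have max{Gap(G), Gap(Ḡ)} ≥ L⁴(1 − U)⁴ / 2¹³. -/
open Classical in
/-- Transition matrix of the simple random walk on `G`:
`P v w = 1/deg(v)` if `v ~ w`, else `0`. -/
noncomputable def transitionMatrix {V : Type*} [Fintype V] (G : SimpleGraph V) :
    Matrix V V ℝ :=
  fun v w => if G.Adj v w then ((G.degree v : ℝ))⁻¹ else 0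

/-- The second-largest eigenvalue of a matrix with real spectrum: the second-largest
root (with multiplicity) of its characteristic polynomial. -/
noncomputable def lambda2 {V : Type*} [Fintype V] [DecidableEq V] (M : Matrix V V ℝ) : ℝ :=
  (M.charpoly.roots.sort (· ≤ ·)).getD ((M.charpoly.roots.sort (· ≤ ·)).length - 2) 0

open Classical in
/-- Spectral gap of the random walk on `G`; by convention `0` if some vertex is isolated. -/
noncomputable def spectralGap {V : Type*} [Fintype V] (G : SimpleGraph V) : ℝ :=
  if ∀ v, 0 < G.degree v then 1 - lambda2 (transitionMatrix G) else 0

section Spectral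

variable {V : Type*} [Fintype V]

/-- At least two indices carry a value no smaller than the second-largest one. -/
lemma exists_ne_getD_sort_le (e : V → ℝ) (hV : 2 ≤ Fintype.card V) {s : Multiset ℝ}
    (hs : s = Multiset.map e Finset.univ.val) :
    ∃ i j, i ≠ j ∧ (s.sort (· ≤ ·)).getD ((s.sort (· ≤ ·)).length - 2) 0 ≤ e i ∧
      (s.sort (· ≤ ·)).getD ((s.sort (· ≤ ·)).length - 2) 0 ≤ e j := by
  classical
  set l := s.sort (· ≤ ·) with hl
  have hlen : l.length = Fintype.card V := by simp [hl, hs, Finset.card_univ]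
  set x := l.getD (l.length - 2) 0 with hx
  have hlt : l.length - 2 < l.length := by omega
  have hx' : x = l[l.length - 2] := by rw [hx, List.getD_eq_getElem _ _ hlt]
  have hsorted : l.Pairwise (· ≤ ·) := Multiset.pairwise_sort s _
  have hdrop : ∀ y ∈ l.drop (l.length - 2), x ≤ y := by
    intro y hy
    obtain ⟨k, hk, rfl⟩ := List.mem_iff_getElem.1 hy
    rw [List.getElem_drop, hx']
    exact hsorted.sortedLE.getElem_le_getElem_of_le (Nat.le_add_right _ _)
  have hcard : 2 ≤ (l.filter (x ≤ ·)).length := by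
    have h1 : (l.drop (l.length - 2)).filter (x ≤ ·) = l.drop (l.length - 2) :=
      List.filter_eq_self.2 fun y hy => decide_eq_true (hdrop y hy)
    have h2 := ((List.drop_sublist (l.length - 2) l).filter (x ≤ ·)).length_le
    rw [h1, List.length_drop] at h2
    omega
  have hcount : (l.filter (x ≤ ·)).length = (Finset.univ.filter (fun i => x ≤ e i)).card := by
    have h1 : (l : Multiset ℝ) = s := Multiset.sort_eq s _
    have h2 : (l.filter (x ≤ ·)).length = (Multiset.filter (x ≤ ·) (l : Multiset ℝ)).card := by
      simp
    rw [h2, h1, hs, Multiset.filter_map, Multiset.card_map]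
    rfl
  rw [hcount] at hcard
  obtain ⟨i, hi, j, hj, hij⟩ := Finset.one_lt_card.1 hcard
  exact ⟨i, j, hij, (Finset.mem_filter.1 hi).2, (Finset.mem_filter.1 hj).2⟩

open Classical in
/-- If no vertex is isolated, some nonzero eigenfunction of the random walk, orthogonal to the
constants with respect to the degree measure, has eigenvalue at least `lambda2`. -/
lemma exists_eigenfunction (G : SimpleGraph V) (hV : 2 ≤ Fintype.card V)
    (hd : ∀ v, 0 < G.degree v) :
    ∃ (f : V → ℝ) (μ : ℝ), lambda2 (transitionMatrix G) ≤ μ ∧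
      (∀ v, ∑ w, (if G.Adj v w then f w else 0) = μ * G.degree v * f v) ∧
      ∑ v, (G.degree v : ℝ) * f v = 0 ∧ f ≠ 0 := by
  have hd' : ∀ v, (0 : ℝ) < G.degree v := fun v => by exact_mod_cast hd v
  set r : V → ℝ := fun v => √(G.degree v : ℝ) with hr
  have hr0 : ∀ v, 0 < r v := fun v => Real.sqrt_pos.2 (hd' v)
  have hrr : ∀ v, r v * r v = G.degree v := fun v => Real.mul_self_sqrt (hd' v).le
  set S : Matrix V V ℝ := fun v w => if G.Adj v w then (r v)⁻¹ * (r w)⁻¹ else 0 with hSdef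
  have hS : S.IsHermitian := by
    refine Matrix.IsHermitian.ext fun v w => ?_
    simp only [hSdef, G.adj_comm w v, mul_comm (r w)⁻¹, star_trivial]
  have hP : transitionMatrix G =
      Matrix.diagonal (fun v => (r v)⁻¹) * (S * Matrix.diagonal r) := by
    ext v w
    rw [Matrix.diagonal_mul, Matrix.mul_diagonal]
    simp only [transitionMatrix, hSdef]
    split_ifs
    · rw [mul_assoc, inv_mul_cancel₀ (hr0 w).ne', ← hrr v, mul_inv, mul_one]
    · simp
  have hchar : (transitionMatrix G).charpoly = S.charpoly := by
    rw [hP, Matrix.charpoly_mul_comm, Matrix.mul_assoc, Matrix.diagonal_mul_diagonal]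
    have : (fun v => r v * (r v)⁻¹) = fun _ => (1 : ℝ) :=
      funext fun v => mul_inv_cancel₀ (hr0 v).ne'
    rw [this, Matrix.diagonal_one, Matrix.mul_one]
  obtain ⟨i, j, hij, hi, hj⟩ := exists_ne_getD_sort_le hS.eigenvalues hV
    (s := (transitionMatrix G).charpoly.roots)
    (by rw [hchar, hS.roots_charpoly_eq_eigenvalues]; rfl)
  set b := hS.eigenvectorBasis
  set F : V → V → ℝ := fun k v => (r v)⁻¹ * b k v with hF
  have hrF : ∀ k v, r v * F k v = b k v := fun k v => by
    rw [hF, mul_inv_cancel_left₀ (hr0 v).ne']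
  have heig : ∀ k v, ∑ w, (if G.Adj v w then F k w else 0)
      = hS.eigenvalues k * G.degree v * F k v := by
    intro k v
    have h := congrFun (hS.mulVec_eigenvectorBasis k) v
    simp only [Matrix.mulVec, dotProduct, Pi.smul_apply, smul_eq_mul] at h
    have h2 : ∑ w, (if G.Adj v w then F k w else 0) = r v * ∑ w, S v w * b k w := by
      rw [Finset.mul_sum]
      refine Finset.sum_congr rfl fun w _ => ?_
      simp only [hSdef, hF]
      split_ifs
      · rw [← mul_assoc, ← mul_assoc, mul_inv_cancel₀ (hr0 v).ne', one_mul]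
      · simp
    rw [h2, h, ← hrF, ← hrr]
    ring
  have hone : ∀ k, ∑ v, (G.degree v : ℝ) * F k v ≠ 0 → hS.eigenvalues k = 1 := by
    intro k hk
    have h1 : ∑ v, ∑ w, (if G.Adj v w then F k w else 0)
        = hS.eigenvalues k * ∑ v, (G.degree v : ℝ) * F k v := by
      rw [Finset.mul_sum]
      exact Finset.sum_congr rfl fun v _ => by rw [heig, mul_assoc]
    have h2 : ∑ v, ∑ w, (if G.Adj v w then F k w else 0)
        = ∑ v, (G.degree v : ℝ) * F k v := by
      rw [Finset.sum_comm]
      refine Finset.sum_congr rfl fun w _ => ?_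
      simp_rw [G.adj_comm _ w]
      rw [← Finset.sum_filter, Finset.sum_const, nsmul_eq_mul, ← G.neighborFinset_eq_filter,
        G.card_neighborFinset_eq_degree]
    exact mul_right_cancel₀ hk (by rw [← h1, h2, one_mul])
  have hne : ∀ k, F k ≠ 0 := by
    intro k h
    refine b.toBasis.ne_zero k ?_
    ext v
    have := hrF k v
    simp only [h, Pi.zero_apply, mul_zero] at this
    simpa using this.symm
  by_cases hbi : ∑ v, (G.degree v : ℝ) * F i v = 0
  · exact ⟨F i, _, hi, heig i, hbi, hne i⟩
  by_cases hbj : ∑ v, (G.degree v : ℝ) * F j v = 0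
  · exact ⟨F j, _, hj, heig j, hbj, hne j⟩
  set p := ∑ v, (G.degree v : ℝ) * F i v with hp
  set q := ∑ v, (G.degree v : ℝ) * F j v with hq
  have hei := heig i
  have hej := heig j
  rw [hone i hbi] at hei hi
  rw [hone j hbj] at hej
  refine ⟨fun v => q * F i v - p * F j v, 1, hi, fun v => ?_, ?_, fun h => hbj ?_⟩
  · have : ∀ w, (if G.Adj v w then q * F i w - p * F j w else 0)
        = q * (if G.Adj v w then F i w else 0) - p * (if G.Adj v w then F j w else 0) := by
      intro w; split_ifs <;> simp
    simp_rw [this]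
    rw [Finset.sum_sub_distrib, ← Finset.mul_sum, ← Finset.mul_sum, hei, hej]
    ring
  · have : ∀ v, (G.degree v : ℝ) * (q * F i v - p * F j v)
        = q * ((G.degree v : ℝ) * F i v) - p * ((G.degree v : ℝ) * F j v) := fun v => by ring
    simp_rw [this]
    rw [Finset.sum_sub_distrib, ← Finset.mul_sum, ← Finset.mul_sum, ← hp, ← hq]
    ring
  · have hlin : q • b i + (-p) • b j = 0 := by
      ext v
      have h' := congrFun h v
      simp only [Pi.zero_apply] at h'
      simp only [PiLp.add_apply, PiLp.smul_apply, smul_eq_mul, PiLp.zero_apply, ← hrF]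
      linear_combination r v * h'
    have h2 := congrArg (fun x => inner ℝ (b i) x) hlin
    simpa [inner_add_right, inner_smul_right, b.inner_eq_one, b.inner_eq_zero hij] using h2

open Classical in
lemma sq_mul_degree_le_of_eigenfunction (G : SimpleGraph V) {f : V → ℝ} {μ : ℝ}
    (hf : ∀ v, ∑ w, (if G.Adj v w then f w else 0) = μ * G.degree v * f v)
    (v : V) (hd : 0 < G.degree v) :
    f v ^ 2 * (μ ^ 2 * G.degree v) ≤ ∑ w, f w ^ 2 := by
  have hd' : (0 : ℝ) < G.degree v := by exact_mod_cast hd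
  have h : (∑ w ∈ G.neighborFinset v, f w) ^ 2
      ≤ (G.neighborFinset v).card * ∑ w ∈ G.neighborFinset v, f w ^ 2 :=
    sq_sum_le_card_mul_sum_sq
  have h1 : ∑ w ∈ G.neighborFinset v, f w = μ * G.degree v * f v := by
    rw [← hf v, G.neighborFinset_eq_filter, Finset.sum_filter]
  have h2 : ∑ w ∈ G.neighborFinset v, f w ^ 2 ≤ ∑ w, f w ^ 2 :=
    Finset.sum_le_sum_of_subset_of_nonneg (Finset.subset_univ _) fun _ _ _ => sq_nonneg _
  rw [h1, G.card_neighborFinset_eq_degree] at h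
  refine le_of_mul_le_mul_left ?_ hd'
  calc (G.degree v : ℝ) * (f v ^ 2 * (μ ^ 2 * G.degree v)) = (μ * G.degree v * f v) ^ 2 := by ring
    _ ≤ _ := h
    _ ≤ _ := by gcongr

open Classical in
lemma sum_adj_eq_sum_degree_mul (G : SimpleGraph V) (h : V → ℝ) :
    ∑ v, ∑ w, (if G.Adj v w then h v else 0) = ∑ v, (G.degree v : ℝ) * h v := by
  refine Finset.sum_congr rfl fun v _ => ?_
  rw [← Finset.sum_filter, Finset.sum_const, nsmul_eq_mul, ← G.neighborFinset_eq_filter,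
    G.card_neighborFinset_eq_degree]

open Classical in
lemma sum_adj_eq_sum_degree_mul' (G : SimpleGraph V) (h : V → ℝ) :
    ∑ v, ∑ w, (if G.Adj v w then h w else 0) = ∑ v, (G.degree v : ℝ) * h v := by
  rw [Finset.sum_comm, ← sum_adj_eq_sum_degree_mul]
  simp_rw [G.adj_comm]

open Classical in
lemma energy_eq_of_eigenfunction (G : SimpleGraph V) {f : V → ℝ} {μ : ℝ}
    (hf : ∀ v, ∑ w, (if G.Adj v w then f w else 0) = μ * G.degree v * f v) :
    ∑ v, ∑ w, (if G.Adj v w then (f v - f w) ^ 2 else 0)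
      = 2 * (1 - μ) * ∑ v, (G.degree v : ℝ) * f v ^ 2 := by
  have h1 : ∀ v w, (if G.Adj v w then (f v - f w) ^ 2 else 0)
      = (if G.Adj v w then f v ^ 2 else 0) + (if G.Adj v w then f w ^ 2 else 0)
        - 2 * f v * (if G.Adj v w then f w else 0) := by
    intro v w; split_ifs <;> ring
  simp_rw [h1, Finset.sum_sub_distrib, Finset.sum_add_distrib, ← Finset.mul_sum, hf]
  rw [sum_adj_eq_sum_degree_mul G fun v => f v ^ 2, sum_adj_eq_sum_degree_mul' G fun v => f v ^ 2]
  have : ∑ v, 2 * f v * (μ * G.degree v * f v) = 2 * μ * ∑ v, (G.degree v : ℝ) * f v ^ 2 := by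
    rw [Finset.mul_sum]
    exact Finset.sum_congr rfl fun v _ => by ring
  rw [this]
  ring

/-- A function with zero weighted mean has its variance about any constant bounded below by its
second moment, when the weights are pinched between `a` and `c`. -/
lemma mul_sum_sq_le_mul_sum_sub_sq {d f : V → ℝ} {a c : ℝ} (m : ℝ) (ha : 0 ≤ a)
    (hd : ∀ v, a ≤ d v) (hd' : ∀ v, d v ≤ c) (hf : ∑ v, d v * f v = 0) :
    a * ∑ v, f v ^ 2 ≤ c * ∑ v, (f v - m) ^ 2 := by
  have h1 : ∑ v, d v * (f v - m) ^ 2 = ∑ v, d v * f v ^ 2 + m ^ 2 * ∑ v, d v := by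
    have : ∀ v, d v * (f v - m) ^ 2 = d v * f v ^ 2 + m ^ 2 * d v - 2 * m * (d v * f v) :=
      fun v => by ring
    simp_rw [this, Finset.sum_sub_distrib, Finset.sum_add_distrib, ← Finset.mul_sum, hf]
    ring
  have h0 : 0 ≤ ∑ v, d v := Finset.sum_nonneg fun v _ => ha.trans (hd v)
  calc a * ∑ v, f v ^ 2 ≤ ∑ v, d v * f v ^ 2 := by
        rw [Finset.mul_sum]
        exact Finset.sum_le_sum fun v _ => by gcongr; exact hd v
    _ ≤ ∑ v, d v * (f v - m) ^ 2 := by rw [h1]; nlinarith [mul_nonneg (sq_nonneg m) h0]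
    _ ≤ c * ∑ v, (f v - m) ^ 2 := by
        rw [Finset.mul_sum]
        exact Finset.sum_le_sum fun v _ => by gcongr; exact hd' v

lemma two_mul_sum_sq_mul_sum_sq_le {f g : V → ℝ} (hf : ∑ v, f v = 0) (hg : ∑ v, g v = 0) :
    2 * ((∑ v, f v ^ 2) * ∑ v, g v ^ 2)
      ≤ ∑ v, ∑ w, (f v - f w) ^ 2 * (g v - g w) ^ 2 := by
  have h : ∀ v w, (f v - f w) ^ 2 * (g v - g w) ^ 2
      = f v ^ 2 * g v ^ 2 + f w ^ 2 * g w ^ 2 + f v ^ 2 * g w ^ 2 + g v ^ 2 * f w ^ 2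
        + 4 * (f v * g v) * (f w * g w) - 2 * (f v ^ 2 * g v) * g w - 2 * (f v * g v ^ 2) * f w
        - 2 * g v * (f w ^ 2 * g w) - 2 * f v * (f w * g w ^ 2) := fun v w => by ring
  simp_rw [h, Finset.sum_sub_distrib, Finset.sum_add_distrib, ← Finset.mul_sum, hf, hg,
    Finset.sum_const, mul_smul_comm, ← Finset.smul_sum, ← Finset.sum_mul, ← Finset.mul_sum, hf, hg]
  have hsq : 0 ≤ ∑ v, f v ^ 2 * g v ^ 2 := Finset.sum_nonneg fun v _ => by positivity
  have hsm : 0 ≤ Finset.univ.card (α := V) • ∑ v, f v ^ 2 * g v ^ 2 := nsmul_nonneg hsq _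
  nlinarith [sq_nonneg (∑ v, f v * g v)]

/-- The same bound for functions that need not be centred. -/
lemma exists_two_mul_variance_mul_variance_le (f g : V → ℝ) :
    ∃ m m' : ℝ, 2 * ((∑ v, (f v - m) ^ 2) * ∑ v, (g v - m') ^ 2)
      ≤ ∑ v, ∑ w, (f v - f w) ^ 2 * (g v - g w) ^ 2 := by
  rcases isEmpty_or_nonempty V with hV | hV
  · exact ⟨0, 0, by simp⟩
  have hc : (Fintype.card V : ℝ) ≠ 0 := by exact_mod_cast Fintype.card_ne_zero
  have hz : ∀ h : V → ℝ, ∑ v, (h v - (∑ w, h w) / Fintype.card V) = 0 := fun h => by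
    rw [Finset.sum_sub_distrib, Finset.sum_const, Finset.card_univ, nsmul_eq_mul,
      mul_div_cancel₀ _ hc, sub_self]
  refine ⟨_, _, (two_mul_sum_sq_mul_sum_sq_le (hz f) (hz g)).trans_eq ?_⟩
  simp

open Classical in
/-- Upper bound on the part of the quartic sum supported on the edges of `G`, given an
eigenfunction `f` of `G` and a bound on `g`. -/
lemma sum_adj_mul_sq_le (G : SimpleGraph V) {f g : V → ℝ} {μ ε B : ℝ}
    (hf : ∀ v, ∑ w, (if G.Adj v w then f w else 0) = μ * G.degree v * f v)
    (hμ : 1 - μ ≤ ε) (hε : 0 ≤ ε) (hg : ∀ v, g v ^ 2 ≤ B) (hB : 0 ≤ B) :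
    ∑ v, ∑ w, (if G.Adj v w then (f v - f w) ^ 2 * (g v - g w) ^ 2 else 0)
      ≤ 8 * B * ε * (Fintype.card V * ∑ v, f v ^ 2) := by
  have hosc : ∀ v w, (g v - g w) ^ 2 ≤ 4 * B := fun v w => by
    nlinarith [hg v, hg w, sq_nonneg (g v + g w)]
  have hdeg : ∑ v, (G.degree v : ℝ) * f v ^ 2 ≤ Fintype.card V * ∑ v, f v ^ 2 := by
    rw [Finset.mul_sum]
    refine Finset.sum_le_sum fun v _ => ?_
    gcongr
    exact (G.degree_lt_card_verts v).le
  have hdeg0 : 0 ≤ ∑ v, (G.degree v : ℝ) * f v ^ 2 := Finset.sum_nonneg fun v _ => by positivity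
  calc ∑ v, ∑ w, (if G.Adj v w then (f v - f w) ^ 2 * (g v - g w) ^ 2 else 0)
      ≤ ∑ v, ∑ w, 4 * B * (if G.Adj v w then (f v - f w) ^ 2 else 0) := by
        refine Finset.sum_le_sum fun v _ => Finset.sum_le_sum fun w _ => ?_
        split_ifs
        · rw [mul_comm]
          gcongr
          exact hosc v w
        · simp
    _ = 4 * B * (2 * (1 - μ) * ∑ v, (G.degree v : ℝ) * f v ^ 2) := by
        simp_rw [← Finset.mul_sum]
        rw [energy_eq_of_eigenfunction G hf]
    _ ≤ 4 * B * (2 * ε * (Fintype.card V * ∑ v, f v ^ 2)) := by gcongr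
    _ = _ := by ring

open Classical in
lemma sum_eq_sum_adj_add_sum_compl_adj {G H : SimpleGraph V} (hH : H = Gᶜ)
    (h : V → V → ℝ)
    (h0 : ∀ v, h v v = 0) :
    ∑ v, ∑ w, h v w = ∑ v, ∑ w, (if G.Adj v w then h v w else 0)
      + ∑ v, ∑ w, (if H.Adj v w then h v w else 0) := by
  simp_rw [← Finset.sum_add_distrib]
  refine Finset.sum_congr rfl fun v _ => Finset.sum_congr rfl fun w _ => ?_
  by_cases hvw : v = w
  · subst hvw; simp [h0]
  · by_cases ha : G.Adj v w <;> simp [hH, SimpleGraph.compl_adj, hvw, ha]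

open Classical in
/-- A random walk on `G` and one on `Gᶜ` cannot both have small spectral gap, when the degrees
are bounded below by `a n` and `b n` respectively. -/
lemma mul_le_of_eigenfunctions [Nonempty V] {G H : SimpleGraph V} (hH : H = Gᶜ)
    {f g : V → ℝ} {μ ν ε a b : ℝ}
    (hf : ∀ v, ∑ w, (if G.Adj v w then f w else 0) = μ * G.degree v * f v)
    (hg : ∀ v, ∑ w, (if H.Adj v w then g w else 0) = ν * H.degree v * g v)
    (hf0 : ∑ v, (G.degree v : ℝ) * f v = 0) (hg0 : ∑ v, (H.degree v : ℝ) * g v = 0)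
    (hfne : f ≠ 0) (hgne : g ≠ 0) (ha : 0 < a) (hb : 0 < b)
    (hda : ∀ v, a * Fintype.card V ≤ G.degree v) (hdb : ∀ v, b * Fintype.card V ≤ H.degree v)
    (hμ : 1 - μ ≤ ε) (hν : 1 - ν ≤ ε) (hε : 0 ≤ ε) (hε' : ε ≤ 1 / 2) :
    a * b * (a * b) ≤ 16 * ε * (a + b) := by
  have hN : (0 : ℝ) < Fintype.card V := by exact_mod_cast Fintype.card_pos
  set N : ℝ := (Fintype.card V : ℝ)
  have hpos : ∀ h : V → ℝ, h ≠ 0 → 0 < ∑ v, h v ^ 2 := fun h hh => by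
    obtain ⟨v, hv⟩ := Function.ne_iff.1 hh
    exact Finset.sum_pos' (fun _ _ => sq_nonneg _) ⟨v, Finset.mem_univ _, by
      have : h v ≠ 0 := hv
      positivity⟩
  have hF := hpos f hfne
  have hG := hpos g hgne
  have hsup : ∀ (K : SimpleGraph V) (h : V → ℝ) (κ c : ℝ), 0 < c → 1 - κ ≤ ε →
      (∀ v, c * N ≤ K.degree v) →
      (∀ v, ∑ w, (if K.Adj v w then h w else 0) = κ * K.degree v * h v) →
      ∀ v, h v ^ 2 ≤ 4 * (∑ w, h w ^ 2) / (c * N) := by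
    intro K h κ c hc hκ hdc hh v
    have hdv : 0 < K.degree v := by
      have : (0 : ℝ) < K.degree v := (mul_pos hc hN).trans_le (hdc v)
      exact_mod_cast this
    have h1 := sq_mul_degree_le_of_eigenfunction K hh v hdv
    have h2 : 1 / 4 ≤ κ ^ 2 := by nlinarith
    have h3 : 1 / 4 * (c * N) ≤ κ ^ 2 * K.degree v := by
      have := hdc v
      gcongr
    rw [le_div_iff₀ (mul_pos hc hN)]
    nlinarith [mul_le_mul_of_nonneg_left h3 (sq_nonneg (h v))]
  have hfB := hsup G f μ a ha hμ hda hf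
  have hgB := hsup H g ν b hb hν hdb hg
  have hf4 := sum_adj_mul_sq_le G hf hμ hε hgB (by positivity)
  have hg4 := sum_adj_mul_sq_le H hg hν hε hfB (by positivity)
  obtain ⟨m, m', hm⟩ := exists_two_mul_variance_mul_variance_le f g
  rw [sum_eq_sum_adj_add_sum_compl_adj hH _ (by simp)] at hm
  simp_rw [mul_comm ((g _ - g _) ^ 2)] at hg4
  have hcard : ∀ (H : SimpleGraph V) (v : V), (H.degree v : ℝ) ≤ N := fun H v =>
    Nat.cast_le.2 (H.degree_lt_card_verts v).le
  have hvf := mul_sum_sq_le_mul_sum_sub_sq m (by positivity) hda (hcard G) hf0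
  have hvg := mul_sum_sq_le_mul_sum_sub_sq m' (by positivity) hdb (hcard H) hg0
  set Sf := ∑ v, f v ^ 2
  set Sg := ∑ v, g v ^ 2
  have hvf' : a * Sf ≤ ∑ v, (f v - m) ^ 2 := le_of_mul_le_mul_left (by linarith) hN
  have hvg' : b * Sg ≤ ∑ v, (g v - m') ^ 2 := le_of_mul_le_mul_left (by linarith) hN
  have hprod : (a * Sf) * (b * Sg) ≤ (∑ v, (f v - m) ^ 2) * ∑ v, (g v - m') ^ 2 := by
    gcongr
  have e1 : 8 * (4 * Sg / (b * N)) * ε * (N * Sf) = 32 * ε * (Sf * Sg) / b := by field_simp; ring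
  have e2 : 8 * (4 * Sf / (a * N)) * ε * (N * Sg) = 32 * ε * (Sf * Sg) / a := by field_simp; ring
  rw [e1] at hf4
  rw [e2] at hg4
  have hfin : 2 * ((a * Sf) * (b * Sg)) ≤ 32 * ε * (Sf * Sg) / b + 32 * ε * (Sf * Sg) / a := by
    linarith
  have e3 : 32 * ε * (Sf * Sg) / b + 32 * ε * (Sf * Sg) / a
      = 32 * ε * (a + b) * (Sf * Sg) / (a * b) := by field_simp
  rw [e3, le_div_iff₀ (mul_pos ha hb)] at hfin
  have hS : 0 < Sf * Sg := mul_pos hF hG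
  refine le_of_mul_le_mul_right ?_ hS
  linarith

end Spectral

open Classical in
/-- **Theorem 1.4.** If `0 < L < U < 1`, `n ≥ 2/(1-U)`, and every vertex degree of `G`
lies in `[Ln, Un]`, then `max(Gap(G), Gap(Ḡ)) ≥ L⁴(1-U)⁴/2¹³`. -/
theorem max_gap_self_compl_of_degree_bounds (L U : ℝ) (hL : 0 < L) (hLU : L < U)
    (hU : U < 1) {V : Type*} [Fintype V] (G : SimpleGraph V)
    (hn : (2 : ℝ) / (1 - U) ≤ Fintype.card V)
    (hdeg : ∀ v : V, L * Fintype.card V ≤ (G.degree v : ℝ) ∧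
      (G.degree v : ℝ) ≤ U * Fintype.card V) :
    L ^ 4 * (1 - U) ^ 4 / 2 ^ 13 ≤ max (spectralGap G) (spectralGap Gᶜ) := by
  classical
  obtain ⟨H, hH⟩ : ∃ H, H = Gᶜ := ⟨_, rfl⟩
  rw [← hH]
  have hU' : 0 < 1 - U := by linarith
  have hN2 : (2 : ℝ) < Fintype.card V := by
    refine lt_of_lt_of_le ?_ hn
    rw [lt_div_iff₀ hU']
    linarith
  have hN : 2 ≤ Fintype.card V := by
    have : 2 < Fintype.card V := by exact_mod_cast hN2
    omega
  have : Nonempty V := Fintype.card_pos_iff.1 (by omega)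
  have hn' : 2 ≤ (1 - U) * Fintype.card V := by
    rw [div_le_iff₀ hU'] at hn
    linarith
  have hda : ∀ v, L * Fintype.card V ≤ (G.degree v : ℝ) := fun v => (hdeg v).1
  have hdb : ∀ v, (1 - U) / 2 * Fintype.card V ≤ (H.degree v : ℝ) := by
    intro v
    have h1 : H.degree v + G.degree v + 1 = Fintype.card V := by
      have h2 : H.degree v = Fintype.card V - 1 - G.degree v := by
        subst hH
        convert G.degree_compl v
      have h3 := G.degree_lt_card_verts v
      omega
    have h2 : (H.degree v : ℝ) + G.degree v + 1 = Fintype.card V := by exact_mod_cast h1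
    have := (hdeg v).2
    linarith
  have hdG : ∀ v, 0 < G.degree v := fun v => by
    have : (0 : ℝ) < G.degree v := lt_of_lt_of_le (by positivity) (hda v)
    exact_mod_cast this
  have hdG' : ∀ v, 0 < H.degree v := fun v => by
    have : (0 : ℝ) < H.degree v := lt_of_lt_of_le (by positivity) (hdb v)
    exact_mod_cast this
  by_contra! hlt
  obtain ⟨h1, h2⟩ := max_lt_iff.1 hlt
  rw [spectralGap, if_pos hdG] at h1
  rw [spectralGap, if_pos hdG'] at h2
  obtain ⟨f, μ, hμ, hf, hf0, hfne⟩ := exists_eigenfunction G hN hdG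
  obtain ⟨g, ν, hν, hg, hg0, hgne⟩ := exists_eigenfunction H hN hdG'
  set t := L * (1 - U) with ht
  have ht0 : 0 < t := mul_pos hL hU'
  have ht1 : t < 1 := by nlinarith
  have hε : L ^ 4 * (1 - U) ^ 4 / 2 ^ 13 = t ^ 4 / 2 ^ 13 := by rw [ht]; ring
  rw [hε] at h1 h2
  have ht2 : t ^ 4 ≤ t ^ 2 := pow_le_pow_of_le_one ht0.le ht1.le (by norm_num)
  have ht3 : t ^ 2 < 1 := by nlinarith
  have key := mul_le_of_eigenfunctions hH hf hg hf0 hg0 hfne hgne hL (half_pos hU') hda hdb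
    (ε := t ^ 4 / 2 ^ 13) (by linarith) (by linarith) (by positivity) (by linarith)
  have e1 : L * ((1 - U) / 2) * (L * ((1 - U) / 2)) = t ^ 2 / 4 := by rw [ht]; ring
  rw [e1] at key
  have hsum : L + (1 - U) / 2 ≤ 2 := by linarith
  have : 16 * (t ^ 4 / 2 ^ 13) * (L + (1 - U) / 2) ≤ 16 * (t ^ 4 / 2 ^ 13) * 2 := by gcongr
  nlinarith [pow_pos ht0 2]
end

section
/- Let K be a positive integer and let G be a finite simple graph on n ≥ 2 vertices such that either the maximum degree satisfies Δ(G) ≥ n − K or the minimum degree satisfies δ(G) ≤ K − 1. Then max{Gap(G), Gap(Ḡ)} ≥ min{ 1/(32(n − 1)), (1/(2K))^{2K} / ((n − 1)(K + 1)) }. -/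
/-- A matrix sharing its characteristic polynomial with a Hermitian matrix `N` of size at least `2`
has its second-largest eigenvalue dominated by two eigenvalues of `N` (with multiplicity). -/
theorem exists_ne_lambda2_le_eigenvalues {V : Type*} [Fintype V] [DecidableEq V]
    {M N : Matrix V V ℝ} (hN : N.IsHermitian) (h : M.charpoly = N.charpoly)
    (hn : 2 ≤ Fintype.card V) :
    ∃ i j, i ≠ j ∧ lambda2 M ≤ hN.eigenvalues i ∧ lambda2 M ≤ hN.eigenvalues j := by
  set l := M.charpoly.roots.sort (· ≤ ·) with hl
  have hroots : (l : Multiset ℝ) = Finset.univ.val.map hN.eigenvalues := by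
    rw [hl, Multiset.sort_eq, h, hN.roots_charpoly_eq_eigenvalues]
    rfl
  have hlen : l.length = Fintype.card V := by
    simpa using congrArg Multiset.card hroots
  have hval : lambda2 M = l[l.length - 2]'(by omega) := by
    rw [lambda2, ← hl, List.getD_eq_getElem _ _ (by omega)]
  have hdrop : ∀ x ∈ l.drop (l.length - 2), lambda2 M ≤ x := by
    intro x hx
    obtain ⟨k, hk, rfl⟩ := List.mem_iff_getElem.1 hx
    rw [List.getElem_drop, hval]
    have hsort : l.Pairwise (· ≤ ·) := Multiset.pairwise_sort _ _
    rcases Nat.eq_zero_or_pos k with rfl | hk0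
    · simp
    · exact List.pairwise_iff_getElem.1 hsort _ _ _ _ (by omega)
  have hcount : 2 ≤ l.countP (lambda2 M ≤ ·) := by
    have h1 : (l.drop (l.length - 2)).countP (lambda2 M ≤ ·) = 2 := by
      rw [List.countP_eq_length.2 (by simpa using hdrop), List.length_drop]
      omega
    rw [← h1]
    exact (List.drop_sublist _ _).countP_le
  have hcard : 1 < (Finset.univ.filter fun i => lambda2 M ≤ hN.eigenvalues i).card := by
    have h2 : Multiset.countP (lambda2 M ≤ ·) (l : Multiset ℝ) =
        (Finset.univ.filter fun i => lambda2 M ≤ hN.eigenvalues i).card := by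
      rw [hroots, Multiset.countP_map]
      rfl
    rw [← h2, Multiset.coe_countP]
    exact hcount
  obtain ⟨i, hi, j, hj, hij⟩ := Finset.one_lt_card.1 hcard
  exact ⟨i, j, hij, (Finset.mem_filter.1 hi).2, (Finset.mem_filter.1 hj).2⟩

/-- If `N` is Hermitian with two eigenvalues exceeding `c`, then its quadratic form exceeds `c` at
some nonzero vector vanishing at a prescribed coordinate. -/
theorem exists_quadratic_form_gt_of_coord_eq_zero {V : Type*} [Fintype V] [DecidableEq V]
    {N : Matrix V V ℝ} (hN : N.IsHermitian) {i j : V} (hij : i ≠ j) {c : ℝ}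
    (hi : c < hN.eigenvalues i) (hj : c < hN.eigenvalues j) (v : V) :
    ∃ w : V → ℝ, w v = 0 ∧ c * (w ⬝ᵥ w) < w ⬝ᵥ (N.mulVec w) := by
  set e := hN.eigenvectorBasis
  have horth : ∀ k l, (e k : V → ℝ) ⬝ᵥ (e l : V → ℝ) = if k = l then 1 else 0 := by
    intro k l
    rw [← orthonormal_iff_ite.1 e.orthonormal k l, EuclideanSpace.inner_eq_star_dotProduct,
      dotProduct_comm]
    simp
  obtain ⟨a, b, hab, hv⟩ : ∃ a b : ℝ, 0 < a ^ 2 + b ^ 2 ∧ a * e i v + b * e j v = 0 := by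
    by_cases h0 : e i v = 0
    · exact ⟨1, 0, by norm_num, by simp [h0]⟩
    · exact ⟨e j v, -e i v,
      add_pos_of_nonneg_of_pos (sq_nonneg _) (sq_pos_iff.2 (neg_ne_zero.2 h0)), by ring⟩
  refine ⟨a • (e i : V → ℝ) + b • (e j : V → ℝ), by simpa using hv, ?_⟩
  rw [Matrix.mulVec_add, Matrix.mulVec_smul, Matrix.mulVec_smul, hN.mulVec_eigenvectorBasis,
    hN.mulVec_eigenvectorBasis]
  change c * _ < (a • (e i : V → ℝ) + b • (e j : V → ℝ)) ⬝ᵥ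
    (a • hN.eigenvalues i • (e i : V → ℝ) + b • hN.eigenvalues j • (e j : V → ℝ))
  simp only [add_dotProduct, dotProduct_add, smul_dotProduct, dotProduct_smul, horth, hij,
    hij.symm, if_true, if_false, smul_eq_mul]
  have hpos : 0 < a ^ 2 * (hN.eigenvalues i - c) + b ^ 2 * (hN.eigenvalues j - c) := by
    rcases (sq_nonneg a).eq_or_lt with ha | ha
    · have hb : 0 < b ^ 2 := by linarith
      have := mul_pos hb (sub_pos.2 hj)
      rw [← ha]
      linarith
    · have h1 := mul_pos ha (sub_pos.2 hi)
      have h2 := mul_nonneg (sq_nonneg b) (sub_pos.2 hj).le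
      linarith
  linarith

open Classical in
/-- The Dirichlet energy of `f` on `G`: the sum of `(f x - f y)²` over the edges of `G`. -/
noncomputable def dirichletEnergy {V : Type*} [Fintype V] (G : SimpleGraph V) (f : V → ℝ) : ℝ :=
  (∑ x, ∑ y, if G.Adj x y then (f x - f y) ^ 2 else 0) / 2

open Classical in
theorem sum_neighbors_sq_le_dirichletEnergy {V : Type*} [Fintype V] (G : SimpleGraph V)
    (f : V → ℝ) (v : V) :
    ∑ y, (if G.Adj v y then (f v - f y) ^ 2 else 0) ≤ dirichletEnergy G f := by
  set a : V → V → ℝ := fun x y => if G.Adj x y then (f x - f y) ^ 2 else 0 with ha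
  have hnn : ∀ x y, 0 ≤ a x y := fun x y => by
    simp only [ha]
    split_ifs <;> positivity
  have hsymm : ∀ x y, a x y = a y x := fun x y => by
    simp only [ha, G.adj_comm x y]
    split_ifs <;> ring
  have hself : a v v = 0 := by simp [ha]
  have h1 : ∑ x, ∑ y, a x y = ∑ y, a v y + ∑ x ∈ Finset.univ.erase v, ∑ y, a x y :=
    (Finset.add_sum_erase _ _ (Finset.mem_univ v)).symm
  have h2 : ∑ x ∈ Finset.univ.erase v, a x v ≤ ∑ x ∈ Finset.univ.erase v, ∑ y, a x y :=
    Finset.sum_le_sum fun x _ =>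
      Finset.single_le_sum (f := a x) (fun y _ => hnn x y) (Finset.mem_univ v)
  have h3 : ∑ y, a v y = ∑ x ∈ Finset.univ.erase v, a x v := by
    rw [← Finset.add_sum_erase _ _ (Finset.mem_univ v), hself, zero_add]
    exact Finset.sum_congr rfl fun x _ => hsymm v x
  change ∑ y, a v y ≤ (∑ x, ∑ y, a x y) / 2
  linarith

theorem dirichletEnergy_nonneg {V : Type*} [Fintype V] (G : SimpleGraph V) (f : V → ℝ) :
    0 ≤ dirichletEnergy G f := by
  classical
  unfold dirichletEnergy
  refine div_nonneg (Finset.sum_nonneg fun x _ => Finset.sum_nonneg fun y _ => ?_) zero_le_two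
  split_ifs <;> positivity

theorem sq_sub_le_dirichletEnergy_of_adj {V : Type*} [Fintype V] (G : SimpleGraph V)
    (f : V → ℝ) {x y : V} (h : G.Adj x y) : (f x - f y) ^ 2 ≤ dirichletEnergy G f := by
  classical
  refine le_trans ?_ (sum_neighbors_sq_le_dirichletEnergy G f x)
  refine le_trans (by simp [h]) (Finset.single_le_sum
    (f := fun z => if G.Adj x z then (f x - f z) ^ 2 else 0) (fun z _ => ?_) (Finset.mem_univ y))
  split_ifs <;> positivity

theorem abs_sub_le_walk_length_mul_sqrt {V : Type*} [Fintype V] {G : SimpleGraph V}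
    (f : V → ℝ) {x y : V} (p : G.Walk x y) :
    |f x - f y| ≤ p.length * √(dirichletEnergy G f) := by
  induction p with
  | nil => simp
  | cons h p ih =>
    rename_i a b c
    have h1 := Real.abs_le_sqrt (sq_sub_le_dirichletEnergy_of_adj G f h)
    have h2 := abs_sub_le (f a) (f b) (f c)
    rw [SimpleGraph.Walk.length_cons]
    push_cast
    linarith

/-- In a connected graph, the vertices beyond the first two on a geodesic from `v` are neither `v`
nor its neighbours, so the geodesic is short when `v` has large degree. -/
theorem SimpleGraph.Connected.dist_add_degree_le_card {V : Type*} [Fintype V]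
    {G : SimpleGraph V} [DecidableRel G.Adj] (hG : G.Connected) (v w : V) :
    G.dist v w + G.degree v ≤ Fintype.card V := by
  classical
  obtain ⟨p, hp, hlen⟩ := hG.exists_path_of_dist v w
  have hnadj : ∀ i, 2 ≤ i → i ≤ p.length → ¬ G.Adj v (p.getVert i) := by
    intro i hi hil hadj
    have := G.dist_le (SimpleGraph.Walk.cons hadj (p.drop i))
    rw [SimpleGraph.Walk.length_cons, SimpleGraph.Walk.drop_length] at this
    omega
  set S := (Finset.Icc 2 p.length).image p.getVert with hS
  have hScard : S.card = p.length - 1 := by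
    rw [hS, Finset.card_image_of_injOn, Nat.card_Icc]
    · omega
    · intro i hi j hj hij
      rw [Finset.coe_Icc, Set.mem_Icc] at hi hj
      exact hp.getVert_injOn hi.2 hj.2 hij
  have hdisj : Disjoint S (insert v (G.neighborFinset v)) := by
    rw [Finset.disjoint_left]
    intro x hx hx'
    obtain ⟨i, hi, rfl⟩ := Finset.mem_image.1 hx
    rw [Finset.mem_Icc] at hi
    rcases Finset.mem_insert.1 hx' with h | h
    · have := (hp.getVert_eq_start_iff hi.2).1 h
      omega
    · exact hnadj i hi.1 hi.2 ((G.mem_neighborFinset _ _).1 h)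
  have hcard := Finset.card_le_univ (S ∪ insert v (G.neighborFinset v))
  rw [Finset.card_union_of_disjoint hdisj, Finset.card_insert_of_notMem (by simp), hScard,
    SimpleGraph.card_neighborFinset_eq_degree] at hcard
  omega

open Classical in
/-- The symmetric matrix `D^{-1/2} A D^{-1/2}`, similar to the transition matrix. -/
noncomputable def normalizedAdjMatrix {V : Type*} [Fintype V] (G : SimpleGraph V) :
    Matrix V V ℝ :=
  fun v w => if G.Adj v w then (√(G.degree v : ℝ))⁻¹ * (√(G.degree w : ℝ))⁻¹ else 0

theorem isHermitian_normalizedAdjMatrix {V : Type*} [Fintype V] (G : SimpleGraph V) :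
    (normalizedAdjMatrix G).IsHermitian := by
  classical
  ext x y
  simp only [normalizedAdjMatrix, Matrix.conjTranspose_apply, star_trivial, G.adj_comm x y]
  split_ifs <;> ring

open Classical in
theorem charpoly_transitionMatrix {V : Type*} [Fintype V] (G : SimpleGraph V)
    (hpos : ∀ v, 0 < G.degree v) :
    (transitionMatrix G).charpoly = (normalizedAdjMatrix G).charpoly := by
  set T : Matrix V V ℝ := Matrix.diagonal fun v => √(G.degree v : ℝ) with hT
  set T' : Matrix V V ℝ := Matrix.diagonal fun v => (√(G.degree v : ℝ))⁻¹ with hT'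
  have hne : ∀ v, √(G.degree v : ℝ) ≠ 0 := fun v =>
    (Real.sqrt_pos.2 (Nat.cast_pos.2 (hpos v))).ne'
  have h1 : transitionMatrix G = T' * (normalizedAdjMatrix G * T) := by
    ext x y
    rw [hT, hT', Matrix.diagonal_mul, Matrix.mul_diagonal, transitionMatrix, normalizedAdjMatrix]
    split_ifs
    · rw [inv_mul_cancel_right₀ (hne y), ← mul_inv, Real.mul_self_sqrt (Nat.cast_nonneg _)]
    · simp
  have h2 : T * T' = 1 := by
    rw [hT, hT', Matrix.diagonal_mul_diagonal, ← Matrix.diagonal_one]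
    congr 1
    funext v
    exact mul_inv_cancel₀ (hne v)
  rw [h1, Matrix.charpoly_mul_comm, mul_assoc, h2, mul_one]

open Classical in
theorem dirichletEnergy_eq {V : Type*} [Fintype V] (G : SimpleGraph V) (f : V → ℝ) :
    dirichletEnergy G f =
      ∑ x, (G.degree x : ℝ) * f x ^ 2 - ∑ x, ∑ y, if G.Adj x y then f x * f y else 0 := by
  have hrow : ∀ x, ∑ y, (if G.Adj x y then f x ^ 2 else 0) = (G.degree x : ℝ) * f x ^ 2 := by
    intro x
    rw [← Finset.sum_filter, Finset.sum_const, nsmul_eq_mul, ← G.neighborFinset_eq_filter,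
      SimpleGraph.card_neighborFinset_eq_degree]
  have hcol : ∑ x, ∑ y, (if G.Adj x y then f y ^ 2 else 0) =
      ∑ x, (G.degree x : ℝ) * f x ^ 2 := by
    rw [Finset.sum_comm]
    simp_rw [← hrow, G.adj_comm]
  have hexp : ∀ x y, (if G.Adj x y then (f x - f y) ^ 2 else 0) =
      (if G.Adj x y then f x ^ 2 else 0) + (if G.Adj x y then f y ^ 2 else 0)
        - 2 * (if G.Adj x y then f x * f y else 0) := by
    intro x y
    split_ifs <;> ring
  simp_rw [dirichletEnergy, hexp, Finset.sum_sub_distrib, Finset.sum_add_distrib,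
    ← Finset.mul_sum, hrow, hcol]
  ring

open Classical in
/-- A Poincaré inequality for functions vanishing at one vertex bounds the gap from below. -/
theorem le_one_sub_lambda2_of_poincare {V : Type*} [Fintype V] (G : SimpleGraph V)
    (hpos : ∀ v, 0 < G.degree v) (hn : 2 ≤ Fintype.card V) (v : V) {g : ℝ}
    (hP : ∀ f : V → ℝ, f v = 0 → g * ∑ x, (G.degree x : ℝ) * f x ^ 2 ≤ dirichletEnergy G f) :
    g ≤ 1 - lambda2 (transitionMatrix G) := by
  by_contra! hlt
  have hN := isHermitian_normalizedAdjMatrix G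
  obtain ⟨i, j, hij, hi, hj⟩ :=
    exists_ne_lambda2_le_eigenvalues hN (charpoly_transitionMatrix G hpos) hn
  obtain ⟨w, hwv, hw⟩ := exists_quadratic_form_gt_of_coord_eq_zero hN hij
    (c := 1 - g) (by linarith) (by linarith) v
  set f : V → ℝ := fun x => (√(G.degree x : ℝ))⁻¹ * w x with hf
  have hnorm : ∑ x, (G.degree x : ℝ) * f x ^ 2 = w ⬝ᵥ w := by
    refine Finset.sum_congr rfl fun x _ => ?_
    have hd : (G.degree x : ℝ) ≠ 0 := Nat.cast_ne_zero.2 (hpos x).ne'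
    rw [hf, mul_pow, inv_pow, Real.sq_sqrt (Nat.cast_nonneg _), mul_inv_cancel_left₀ hd, sq]
  have hquad : ∑ x, ∑ y, (if G.Adj x y then f x * f y else 0) =
      w ⬝ᵥ (normalizedAdjMatrix G).mulVec w := by
    simp only [dotProduct, Matrix.mulVec, Finset.mul_sum, normalizedAdjMatrix, hf]
    refine Finset.sum_congr rfl fun x _ => Finset.sum_congr rfl fun y _ => ?_
    split_ifs <;> ring
  have := hP f (by simp [hf, hwv])
  rw [dirichletEnergy_eq, hnorm, hquad] at this
  linarith

open Classical in
theorem sum_degree_mul_sq_le {V : Type*} [Fintype V] {G : SimpleGraph V} (hG : G.Connected)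
    {v : V} {K : ℕ} (hK : 0 < K) (hv : Fintype.card V ≤ G.degree v + K) {f : V → ℝ}
    (hf : f v = 0) :
    ∑ x, (G.degree x : ℝ) * f x ^ 2 ≤
      ((Fintype.card V : ℝ) - 1) * (K : ℝ) ^ 3 * dirichletEnergy G f := by
  set E := dirichletEnergy G f with hE
  have hE0 : 0 ≤ E := dirichletEnergy_nonneg G f
  have hK1 : (1 : ℝ) ≤ K := by exact_mod_cast hK
  have hdeg : ∀ x, (G.degree x : ℝ) ≤ (Fintype.card V : ℝ) - 1 := by
    intro x
    have : (G.degree x : ℝ) + 1 ≤ Fintype.card V := by exact_mod_cast G.degree_lt_card_verts x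
    linarith
  have hall : ∀ x, f x ^ 2 ≤ (K : ℝ) ^ 2 * E := by
    intro x
    obtain ⟨p, hp⟩ := hG.exists_walk_length_eq_dist v x
    have hpK : (p.length : ℝ) ≤ K := by
      have := hG.dist_add_degree_le_card v x
      exact_mod_cast (by omega : p.length ≤ K)
    have h1 := abs_sub_le_walk_length_mul_sqrt f p
    rw [hf, zero_sub, abs_neg] at h1
    have h2 : |f x| ≤ K * √E :=
      h1.trans (mul_le_mul_of_nonneg_right hpK (Real.sqrt_nonneg _))
    calc f x ^ 2 = |f x| ^ 2 := (sq_abs _).symm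
      _ ≤ (K * √E) ^ 2 := by gcongr
      _ = (K : ℝ) ^ 2 * E := by rw [mul_pow, Real.sq_sqrt hE0]
  have hnear : ∑ x ∈ G.neighborFinset v, f x ^ 2 ≤ E := by
    refine le_trans (le_of_eq ?_) (sum_neighbors_sq_le_dirichletEnergy G f v)
    rw [← Finset.sum_filter, ← G.neighborFinset_eq_filter]
    simp [hf]
  have hfar : ∑ x ∈ Finset.univ \ insert v (G.neighborFinset v), f x ^ 2 ≤
      ((K : ℝ) - 1) * ((K : ℝ) ^ 2 * E) := by
    refine (Finset.sum_le_card_nsmul _ _ _ fun x _ => hall x).trans ?_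
    rw [nsmul_eq_mul]
    refine mul_le_mul_of_nonneg_right ?_ (by positivity)
    rw [← Finset.compl_eq_univ_sdiff, Finset.card_compl,
      Finset.card_insert_of_notMem (by simp), SimpleGraph.card_neighborFinset_eq_degree]
    have : Fintype.card V - (G.degree v + 1) + 1 ≤ K := by omega
    have : ((Fintype.card V - (G.degree v + 1) : ℕ) : ℝ) + 1 ≤ K := by exact_mod_cast this
    linarith
  have htotal : ∑ x, f x ^ 2 ≤ (K : ℝ) ^ 3 * E := by
    rw [← Finset.sum_sdiff (Finset.subset_univ (insert v (G.neighborFinset v))),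
      Finset.sum_insert (by simp), hf]
    nlinarith [mul_nonneg hE0 (by nlinarith : (0 : ℝ) ≤ (K : ℝ) ^ 2 - 1)]
  calc ∑ x, (G.degree x : ℝ) * f x ^ 2
      ≤ ∑ x, ((Fintype.card V : ℝ) - 1) * f x ^ 2 :=
        Finset.sum_le_sum fun x _ => mul_le_mul_of_nonneg_right (hdeg x) (sq_nonneg _)
    _ = ((Fintype.card V : ℝ) - 1) * ∑ x, f x ^ 2 := by rw [Finset.mul_sum]
    _ ≤ ((Fintype.card V : ℝ) - 1) * ((K : ℝ) ^ 3 * E) :=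
        mul_le_mul_of_nonneg_left htotal ((Nat.cast_nonneg _).trans (hdeg v))
    _ = _ := by ring

open Classical in
theorem inv_le_spectralGap_of_connected {V : Type*} [Fintype V] {G : SimpleGraph V}
    (hG : G.Connected) (hn : 2 ≤ Fintype.card V) {v : V} {K : ℕ} (hK : 0 < K)
    (hv : Fintype.card V ≤ G.degree v + K) :
    (((Fintype.card V : ℝ) - 1) * (K : ℝ) ^ 3)⁻¹ ≤ spectralGap G := by
  have : Nontrivial V := Fintype.one_lt_card_iff_nontrivial.1 hn
  have hpos : ∀ x, 0 < G.degree x := fun x => hG.preconnected.degree_pos_of_nontrivial x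
  have hn' : (2 : ℝ) ≤ Fintype.card V := by exact_mod_cast hn
  have hK' : (0 : ℝ) < K := by exact_mod_cast hK
  rw [spectralGap, if_pos hpos]
  refine le_one_sub_lambda2_of_poincare G hpos hn v fun f hf => ?_
  rw [inv_mul_le_iff₀ (mul_pos (by linarith) (by positivity))]
  exact sum_degree_mul_sq_le hG hK hv hf

open Classical in
theorem degree_add_degree_add_two_le_card_of_not_reachable {V : Type*} [Fintype V]
    {G : SimpleGraph V} {v u : V} (h : ¬ G.Reachable v u) :
    G.degree v + G.degree u + 2 ≤ Fintype.card V := by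
  have hdisj : Disjoint (insert v (G.neighborFinset v)) (insert u (G.neighborFinset u)) := by
    rw [Finset.disjoint_left]
    intro x hx hx'
    have h1 : G.Reachable v x := by
      rcases Finset.mem_insert.1 hx with rfl | hx
      · rfl
      · exact ((G.mem_neighborFinset _ _).1 hx).reachable
    have h2 : G.Reachable u x := by
      rcases Finset.mem_insert.1 hx' with rfl | hx
      · rfl
      · exact ((G.mem_neighborFinset _ _).1 hx).reachable
    exact h (h1.trans h2.symm)
  have hcard := Finset.card_le_univ
    (insert v (G.neighborFinset v) ∪ insert u (G.neighborFinset u))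
  rw [Finset.card_union_of_disjoint hdisj, Finset.card_insert_of_notMem (by simp),
    Finset.card_insert_of_notMem (by simp), SimpleGraph.card_neighborFinset_eq_degree,
    SimpleGraph.card_neighborFinset_eq_degree] at hcard
  omega

open Classical in
theorem inv_le_max_spectralGap {V : Type*} [Fintype V] {G : SimpleGraph V}
    (hn : 2 ≤ Fintype.card V) {v : V} {K : ℕ} (hK : 0 < K)
    (hv : Fintype.card V ≤ G.degree v + K) :
    (((Fintype.card V : ℝ) - 1) * (K : ℝ) ^ 3)⁻¹ ≤ max (spectralGap G) (spectralGap Gᶜ) := by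
  by_cases hG : G.Connected
  · exact le_max_of_le_left (inv_le_spectralGap_of_connected hG hn hK hv)
  have : Nonempty V := ⟨v⟩
  have hGc : Gᶜ.Connected := G.connected_or_connected_compl.resolve_left hG
  obtain ⟨u, hu⟩ : ∃ u, ¬ G.Reachable v u := by
    by_contra! hall
    exact hG ⟨fun x y => (hall x).symm.trans (hall y)⟩
  have hcard := degree_add_degree_add_two_le_card_of_not_reachable hu
  refine le_max_of_le_right (inv_le_spectralGap_of_connected (v := u) hGc hn hK ?_)
  rw [G.degree_compl]
  omega

theorem pow_div_le_inv_cube {K : ℕ} (hK : 0 < K) :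
    ((1 : ℝ) / (2 * K)) ^ (2 * K) / (K + 1) ≤ ((K : ℝ) ^ 3)⁻¹ := by
  have hK1 : (1 : ℝ) ≤ K := by exact_mod_cast hK
  have h1 : ((1 : ℝ) / (2 * K)) ^ (2 * K) ≤ (1 / (2 * K)) ^ 2 :=
    pow_le_pow_of_le_one (by positivity) (by rw [div_le_one (by positivity)]; linarith) (by omega)
  calc ((1 : ℝ) / (2 * K)) ^ (2 * K) / (K + 1)
      ≤ (1 / (2 * K)) ^ 2 / (K + 1) := by gcongr
    _ = (4 * (K : ℝ) ^ 2 * (K + 1))⁻¹ := by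
        field_simp
        norm_num
    _ ≤ ((K : ℝ) ^ 3)⁻¹ := by
        gcongr
        nlinarith [pow_pos (zero_lt_one.trans_le hK1) 2, pow_pos (zero_lt_one.trans_le hK1) 3]

open Classical in
/-- **Corollary 3.4.** If `G` has `n ≥ 2` vertices and `Δ(G) ≥ n - K` or
`δ(G) ≤ K - 1` for a positive integer `K`, then
`max(Gap(G), Gap(Ḡ)) ≥ min( 1/(32(n-1)), (1/(2K))^(2K)/((n-1)(K+1)) )`. -/
theorem max_gap_self_compl_of_extreme_degree {V : Type*} [Fintype V]
    (G : SimpleGraph V) (hn : 2 ≤ Fintype.card V) (K : ℕ) (hK : 0 < K)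
    (hdeg : (Fintype.card V : ℝ) - K ≤ (G.maxDegree : ℝ) ∨ G.minDegree ≤ K - 1) :
    min (1 / (32 * ((Fintype.card V : ℝ) - 1)))
        (((1 : ℝ) / (2 * K)) ^ (2 * K) / (((Fintype.card V : ℝ) - 1) * (K + 1))) ≤
      max (spectralGap G) (spectralGap Gᶜ) := by
  have hn' : (2 : ℝ) ≤ Fintype.card V := by exact_mod_cast hn
  have : Nonempty V := Fintype.card_pos_iff.1 (by omega)
  have hbound : (((Fintype.card V : ℝ) - 1) * (K : ℝ) ^ 3)⁻¹ ≤
      max (spectralGap G) (spectralGap Gᶜ) := by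
    rcases hdeg with h | h
    · obtain ⟨v, hv⟩ := G.exists_maximal_degree_vertex
      rw [hv] at h
      have h' : (Fintype.card V : ℝ) ≤ G.degree v + K := by linarith
      exact inv_le_max_spectralGap hn hK (by exact_mod_cast h')
    · obtain ⟨v, hv⟩ := G.exists_minimal_degree_vertex
      have := inv_le_max_spectralGap (G := Gᶜ) hn (v := v) hK (by rw [G.degree_compl]; omega)
      rwa [compl_compl, max_comm] at this
  refine (min_le_right _ _).trans (le_trans ?_ hbound)
  rw [mul_comm (_ - 1 : ℝ) (K + 1 : ℝ), ← div_div, div_eq_inv_mul, mul_inv]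
  exact mul_le_mul_of_nonneg_left (pow_div_le_inv_cube hK) (inv_nonneg.2 (by linarith))
end

section
/- Let G be a connected finite simple graph on n vertices such that both G and its complement Ḡ are connected with diameter exactly 3. Then max{Gap(G), Gap(Ḡ)} ≥ ((3 − √5)/8) · (1/(n − 1)). -/
open Matrix in
/-- If the quadratic form of a Hermitian `S` is at most `t` times the squared norm on a coordinate
hyperplane, then the second-largest eigenvalue is at most `t`. -/
lemma lambda2_le_of_charpoly_eq {V : Type*} [Fintype V] [DecidableEq V] {M S : Matrix V V ℝ}
    (hS : S.IsHermitian) (hM : M.charpoly = S.charpoly) (hV : 2 ≤ Fintype.card V) (y : V) (t : ℝ)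
    (h : ∀ w : V → ℝ, w y = 0 → w ⬝ᵥ S *ᵥ w ≤ t * (w ⬝ᵥ w)) : lambda2 M ≤ t := by
  classical
  have hroots : M.charpoly.roots = Finset.univ.val.map hS.eigenvalues := by
    rw [hM, hS.roots_charpoly_eq_eigenvalues]; rfl
  by_contra! hlt
  unfold lambda2 at hlt
  set l := M.charpoly.roots.sort (· ≤ ·) with hl
  have hlen : l.length = Fintype.card V := by
    rw [hl, Multiset.length_sort, hroots]; simp
  have hidx : l.length - 2 < l.length := by omega
  have hsorted : l.Pairwise (· ≤ ·) := Multiset.pairwise_sort _ _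
  rw [List.getD_eq_getElem _ _ hidx] at hlt
  have hcount : 2 ≤ l.countP (fun z => decide (t < z)) := by
    have hdrop : (l.drop (l.length - 2)).countP (fun z => decide (t < z)) = 2 := by
      rw [List.countP_eq_length.2]
      · rw [List.length_drop]; omega
      · intro z hz
        obtain ⟨i, hi, rfl⟩ := List.mem_iff_getElem.1 hz
        rw [List.getElem_drop]
        simp only [decide_eq_true_eq]
        refine hlt.trans_le ?_
        rcases Nat.eq_zero_or_pos i with rfl | hpos
        · simp
        · exact List.pairwise_iff_getElem.1 hsorted _ _ _ _ (by omega)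
    rw [← hdrop]
    exact (List.drop_sublist _ _).countP_le
  have hcard : 1 < (Finset.univ.filter fun i => t < hS.eigenvalues i).card := by
    have h1 : (l : Multiset ℝ).countP (fun z => t < z) = l.countP (fun z => decide (t < z)) :=
      Multiset.coe_countP _ _
    rw [hl, Multiset.sort_eq, hroots, Multiset.countP_map, ← hroots, ← hl] at h1
    have h2 : (Finset.univ.filter fun i => t < hS.eigenvalues i).card
      = l.countP (fun z => decide (t < z)) := h1
    omega
  obtain ⟨i, hi, j, hj, hij⟩ := Finset.one_lt_card.1 hcard
  simp only [Finset.mem_filter, Finset.mem_univ, true_and] at hi hj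
  have horth : ∀ i j, ⇑(hS.eigenvectorBasis i) ⬝ᵥ ⇑(hS.eigenvectorBasis j)
      = if i = j then (1 : ℝ) else 0 := by
    intro i j
    have := orthonormal_iff_ite.1 hS.eigenvectorBasis.orthonormal j i
    rw [EuclideanSpace.inner_eq_star_dotProduct] at this
    simpa [eq_comm] using this
  set p : V → ℝ := ⇑(hS.eigenvectorBasis i) with hp
  set q : V → ℝ := ⇑(hS.eigenvectorBasis j) with hq
  have hpp : p ⬝ᵥ p = 1 := by simp [hp, horth]
  have hqq : q ⬝ᵥ q = 1 := by simp [hq, horth]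
  have hpq : p ⬝ᵥ q = 0 := by simp [hp, hq, horth, hij]
  have hqp : q ⬝ᵥ p = 0 := by simp [hp, hq, horth, hij.symm]
  have hSp : S *ᵥ p = hS.eigenvalues i • p := hS.mulVec_eigenvectorBasis i
  have hSq : S *ᵥ q = hS.eigenvalues j • q := hS.mulVec_eigenvectorBasis j
  obtain ⟨a, b, hab, hne⟩ : ∃ a b : ℝ, a * p y + b * q y = 0 ∧ 0 < a ^ 2 + b ^ 2 := by
    by_cases hy : p y = 0
    · exact ⟨1, 0, by simp [hy], by norm_num⟩
    · have hy' : -p y ≠ 0 := neg_ne_zero.2 hy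
      exact ⟨q y, -p y, by ring, by positivity⟩
  have key := h (a • p + b • q) (by simpa using hab)
  simp only [mulVec_add, mulVec_smul, hSp, hSq, dotProduct_add, add_dotProduct, smul_dotProduct,
    dotProduct_smul, hpp, hqq, hpq, hqp, smul_eq_mul] at key
  rcases (sq_nonneg a).eq_or_lt with ha | ha
  · nlinarith [mul_pos (show 0 < b ^ 2 by linarith) (sub_pos.2 hj)]
  · nlinarith [mul_pos ha (sub_pos.2 hi), mul_nonneg (sq_nonneg b) (sub_pos.2 hj).le]

open Classical in
/-- The Dirichlet form of `G`, summed over ordered pairs of adjacent vertices. -/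
noncomputable def dirichletForm {V : Type*} [Fintype V] (G : SimpleGraph V) (f : V → ℝ) : ℝ :=
  ∑ a, ∑ b, if G.Adj a b then (f a - f b) ^ 2 else 0

open Matrix Classical in
lemma le_spectralGap_of_le_dirichletForm {V : Type*} [Fintype V] (G : SimpleGraph V)
    [Nontrivial V] (hconn : G.Connected) (y : V) (c : ℝ) (hc : 0 ≤ c)
    (h : ∀ f : V → ℝ, f y = 0 → 2 * c * ∑ v, f v ^ 2 ≤ dirichletForm G f) :
    c * (1 / ((Fintype.card V : ℝ) - 1)) ≤ spectralGap G := by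
  have hV : 2 ≤ Fintype.card V := Fintype.one_lt_card
  have hdeg : ∀ v, 0 < G.degree v := fun v => hconn.preconnected.degree_pos_of_nontrivial v
  rw [spectralGap, if_pos hdeg]
  set s : V → ℝ := fun v => (√(G.degree v : ℝ))⁻¹ with hs
  have hdpos : ∀ v, (0 : ℝ) < G.degree v := fun v => by exact_mod_cast hdeg v
  have hss : ∀ v, s v ^ 2 * G.degree v = 1 := fun v => by
    rw [hs]; simp only [inv_pow, Real.sq_sqrt (hdpos v).le]
    exact inv_mul_cancel₀ (hdpos v).ne'
  have hnpos : (0 : ℝ) < (Fintype.card V : ℝ) - 1 := by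
    have : (2 : ℝ) ≤ Fintype.card V := by exact_mod_cast hV
    linarith
  set A : Matrix V V ℝ := fun v w => if G.Adj v w then 1 else 0 with hA
  have hP : transitionMatrix G = diagonal s * (diagonal s * A) := by
    ext v w
    rw [diagonal_mul, diagonal_mul, transitionMatrix, hA]
    by_cases hvw : G.Adj v w
    · simp only [hvw, if_true, hs, mul_one]
      rw [← mul_inv, Real.mul_self_sqrt (hdpos v).le]
    · simp [hvw]
  set S : Matrix V V ℝ := diagonal s * A * diagonal s with hSdef
  have hSapp : ∀ v w, S v w = if G.Adj v w then s v * s w else 0 := fun v w => by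
    rw [hSdef, mul_diagonal, diagonal_mul, hA]
    by_cases hvw : G.Adj v w <;> simp [hvw]
  have hSherm : S.IsHermitian := by
    ext v w
    simp only [conjTranspose_apply, hSapp, star_trivial, G.adj_comm w v, mul_comm (s w)]
  have hchar : (transitionMatrix G).charpoly = S.charpoly := by
    rw [hP, charpoly_mul_comm]
  have := lambda2_le_of_charpoly_eq hSherm hchar hV y (1 - c * (1 / ((Fintype.card V : ℝ) - 1)))
    fun w hw => ?_
  · linarith
  have hf := h (fun v => s v * w v) (by simp [hw])
  have hsum : c * (1 / ((Fintype.card V : ℝ) - 1)) * ∑ v, w v ^ 2 ≤ c * ∑ v, (s v * w v) ^ 2 := by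
    rw [mul_assoc, Finset.mul_sum]
    refine mul_le_mul_of_nonneg_left (Finset.sum_le_sum fun v _ => ?_) hc
    rw [mul_pow]
    refine mul_le_mul_of_nonneg_right ?_ (sq_nonneg _)
    rw [div_le_iff₀ hnpos]
    refine (hss v).ge.trans ?_
    refine mul_le_mul_of_nonneg_left ?_ (sq_nonneg _)
    have : (G.degree v : ℝ) + 1 ≤ Fintype.card V := by exact_mod_cast G.degree_lt_card_verts v
    linarith
  have hquad : w ⬝ᵥ S *ᵥ w = ∑ a, ∑ b, if G.Adj a b then s a * w a * (s b * w b) else 0 := by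
    simp only [dotProduct, mulVec, Finset.mul_sum, hSapp]
    refine Finset.sum_congr rfl fun a _ => Finset.sum_congr rfl fun b _ => ?_
    split_ifs <;> ring
  have hrow : ∑ a, ∑ b, (if G.Adj a b then (s a * w a) ^ 2 else 0) = ∑ a, w a ^ 2 := by
    refine Finset.sum_congr rfl fun a _ => ?_
    rw [← Finset.sum_filter, Finset.sum_const, nsmul_eq_mul, ← G.neighborFinset_eq_filter,
      G.card_neighborFinset_eq_degree]
    linear_combination (w a ^ 2) * hss a
  have hcol : ∑ a, ∑ b, (if G.Adj a b then (s b * w b) ^ 2 else 0) = ∑ a, w a ^ 2 := by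
    rw [Finset.sum_comm, ← hrow]
    simp only [G.adj_comm]
  have hdir : dirichletForm G (fun v => s v * w v) = 2 * ∑ a, w a ^ 2 - 2 * (w ⬝ᵥ S *ᵥ w) := by
    rw [hquad, two_mul]
    nth_rewrite 1 [← hrow]
    rw [← hcol, dirichletForm]
    simp only [Finset.mul_sum, ← Finset.sum_add_distrib, ← Finset.sum_sub_distrib]
    refine Finset.sum_congr rfl fun a _ => Finset.sum_congr rfl fun b _ => ?_
    split_ifs <;> ring
  have hww : w ⬝ᵥ w = ∑ a, w a ^ 2 := by simp [dotProduct, sq]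
  rw [hww]
  linarith

/-- `G` contains the double star with adjacent centres `x`, `y` and leaf sets `C`, `D`, and every
vertex of `G` belongs to it. -/
structure SpansDoubleStar {V : Type*} [DecidableEq V] (G : SimpleGraph V) (x y : V)
    (C D : Finset V) : Prop where
  adj : G.Adj x y
  adj_left : ∀ z ∈ C, G.Adj x z
  adj_right : ∀ z ∈ D, G.Adj y z
  disjoint : Disjoint C D
  left_notMem : x ∉ C ∪ D
  right_notMem : y ∉ C ∪ D
  cover : ∀ z, z = x ∨ z = y ∨ z ∈ C ∨ z ∈ D

lemma SpansDoubleStar.symm {V : Type*} [DecidableEq V] {G : SimpleGraph V} {x y : V}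
    {C D : Finset V} (h : SpansDoubleStar G x y C D) : SpansDoubleStar G y x D C where
  adj := h.adj.symm
  adj_left := h.adj_right
  adj_right := h.adj_left
  disjoint := h.disjoint.symm
  left_notMem := by rw [Finset.union_comm]; exact h.right_notMem
  right_notMem := by rw [Finset.union_comm]; exact h.left_notMem
  cover z := by have := h.cover z; tauto

lemma sum_sum_insert_of_symm {V : Type*} [DecidableEq V] (e : V → V → ℝ)
    (hsymm : ∀ a b, e a b = e b a) (hdiag : ∀ a, e a a = 0) {a : V} {S : Finset V} (ha : a ∉ S) :
    ∑ b ∈ insert a S, ∑ c ∈ insert a S, e b c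
      = ∑ b ∈ S, ∑ c ∈ S, e b c + 2 * ∑ c ∈ S, e a c := by
  simp only [Finset.sum_insert ha, Finset.sum_add_distrib, hdiag, zero_add, hsymm _ a]
  ring

open Classical in
/-- If the leaf sets of a spanning double star are joined through many disjoint routes of
conductance `ω`, then the Dirichlet form has a spectral gap. -/
lemma SpansDoubleStar.le_dirichletForm {V : Type*} [Fintype V] {G : SimpleGraph V}
    {x y : V} {C D : Finset V} (h : SpansDoubleStar G x y C D) {ι : Type*} [Fintype ι] {p q : ι → V}
    (hp : p.Injective) (hq : q.Injective) (hpC : ∀ i, p i ∈ C) (hqD : ∀ i, q i ∈ D) {ω κ : ℝ}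
    (hloc : ∀ t s ρ : ℝ, κ * ρ ^ 2 ≤
      ((t - ρ) ^ 2 - t ^ 2 / 10 + ρ ^ 2 / 9) + 9 / 10 * s ^ 2 + ω * (t - s) ^ 2)
    (hcount : (C.card : ℝ) / 9 ≤ κ * Fintype.card ι + 9 / 10)
    (f : V → ℝ) (hf : f y = 0)
    (hinner : 2 * (ω * ∑ i, (f (p i) - f (q i)) ^ 2) ≤
      ∑ a ∈ C ∪ D, ∑ b ∈ C ∪ D, if G.Adj a b then (f a - f b) ^ 2 else 0) :
    2 * (1 / 10) * ∑ v, f v ^ 2 ≤ dirichletForm G f := by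
  set e : V → V → ℝ := fun a b => if G.Adj a b then (f a - f b) ^ 2 else 0 with he
  have hsymm : ∀ a b, e a b = e b a := fun a b => by
    simp only [he, G.adj_comm a b, sub_sq_comm (f a)]
  have hdiag : ∀ a, e a a = 0 := fun a => by simp [he]
  have hnonneg : ∀ a b, 0 ≤ e a b := fun a b => by
    simp only [he]; split_ifs <;> positivity
  have huniv : (Finset.univ : Finset V) = insert x (insert y (C ∪ D)) := by
    ext z; simpa using h.cover z
  have hx : x ∉ insert y (C ∪ D) := by
    rw [Finset.mem_insert, not_or]; exact ⟨h.adj.ne, h.left_notMem⟩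
  have hform : dirichletForm G f = ∑ a ∈ C ∪ D, ∑ b ∈ C ∪ D, e a b
      + 2 * ∑ b ∈ C ∪ D, e y b + 2 * (e x y + ∑ b ∈ C ∪ D, e x b) := by
    rw [dirichletForm, huniv, sum_sum_insert_of_symm e hsymm hdiag hx,
      sum_sum_insert_of_symm e hsymm hdiag h.right_notMem, Finset.sum_insert h.right_notMem]
  have hnorm : ∑ v, f v ^ 2 = f x ^ 2 + (∑ z ∈ C, f z ^ 2 + ∑ z ∈ D, f z ^ 2) := by
    rw [huniv, Finset.sum_insert hx, Finset.sum_insert h.right_notMem,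
      Finset.sum_union h.disjoint, hf]
    ring
  have hexy : e x y = f x ^ 2 := by simp [he, h.adj, hf]
  have hC : ∑ z ∈ C, (f z - f x) ^ 2 ≤ ∑ b ∈ C ∪ D, e x b := by
    refine le_of_eq_of_le (Finset.sum_congr rfl fun z hz => ?_)
      (Finset.sum_le_sum_of_subset_of_nonneg Finset.subset_union_left fun z _ _ => hnonneg x z)
    simp only [he, h.adj_left z hz, if_true]; ring
  have hD : ∑ z ∈ D, f z ^ 2 ≤ ∑ b ∈ C ∪ D, e y b := by
    refine le_of_eq_of_le (Finset.sum_congr rfl fun z hz => ?_)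
      (Finset.sum_le_sum_of_subset_of_nonneg Finset.subset_union_right fun z _ _ => hnonneg y z)
    simp only [he, h.adj_right z hz, if_true, hf]; ring
  have hsumC : ∑ i, ((f (p i) - f x) ^ 2 - f (p i) ^ 2 / 10 + f x ^ 2 / 9) ≤
      ∑ z ∈ C, ((f z - f x) ^ 2 - f z ^ 2 / 10 + f x ^ 2 / 9) := by
    rw [← Finset.sum_image (f := fun z => (f z - f x) ^ 2 - f z ^ 2 / 10 + f x ^ 2 / 9) hp.injOn]
    refine Finset.sum_le_sum_of_subset_of_nonneg ?_ fun z _ _ => ?_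
    · intro z; simp only [Finset.mem_image]; rintro ⟨i, -, rfl⟩; exact hpC i
    · nlinarith [sq_nonneg (9 * f z - 10 * f x)]
  have hsumD : ∑ i, 9 / 10 * f (q i) ^ 2 ≤ ∑ z ∈ D, 9 / 10 * f z ^ 2 := by
    rw [← Finset.sum_image (f := fun z => 9 / 10 * f z ^ 2) hq.injOn]
    refine Finset.sum_le_sum_of_subset_of_nonneg ?_ fun z _ _ => by positivity
    intro z; simp only [Finset.mem_image]; rintro ⟨i, -, rfl⟩; exact hqD i
  have hsum : ∑ _i : ι, κ * f x ^ 2 ≤ ∑ i, (((f (p i) - f x) ^ 2 - f (p i) ^ 2 / 10 + f x ^ 2 / 9)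
      + 9 / 10 * f (q i) ^ 2 + ω * (f (p i) - f (q i)) ^ 2) :=
    Finset.sum_le_sum fun i _ => hloc _ _ _
  rw [Finset.sum_add_distrib, Finset.sum_add_distrib,
    ← Finset.mul_sum (f := fun i => (f (p i) - f (q i)) ^ 2), Finset.sum_const,
    Finset.card_univ, nsmul_eq_mul] at hsum
  have hsplit : ∑ z ∈ C, ((f z - f x) ^ 2 - f z ^ 2 / 10 + f x ^ 2 / 9) =
      ∑ z ∈ C, (f z - f x) ^ 2 - (∑ z ∈ C, f z ^ 2) / 10 + C.card * (f x ^ 2 / 9) := by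
    rw [Finset.sum_add_distrib, Finset.sum_sub_distrib, ← Finset.sum_div, Finset.sum_const,
      nsmul_eq_mul]
  rw [← Finset.mul_sum (s := D)] at hsumD
  rw [hform, hnorm, hexy]
  nlinarith [mul_le_mul_of_nonneg_right hcount (sq_nonneg (f x))]

open Classical in
/-- A smallest vertex cover of the edges of `G` between `A` and `B` satisfies Hall's condition
from its part in `A` to the uncovered part of `B`. -/
lemma exists_injective_of_min_cover {V : Type*} (G : SimpleGraph V) {A B K : Finset V}
    (hAB : Disjoint A B) (hcov : ∀ a ∈ A, ∀ b ∈ B, G.Adj a b → a ∈ K ∨ b ∈ K)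
    (hmin : ∀ K' : Finset V, (∀ a ∈ A, ∀ b ∈ B, G.Adj a b → a ∈ K' ∨ b ∈ K') →
      K.card ≤ K'.card) :
    ∃ g : ↥(K ∩ A) → V, g.Injective ∧ ∀ i : ↥(K ∩ A), g i ∈ B ∧ g i ∉ K ∧ G.Adj i (g i) := by
  obtain ⟨g, hg, hgmem⟩ := (Finset.all_card_le_biUnion_card_iff_exists_injective
      (fun i : ↥(K ∩ A) => (B \ K).filter (fun b => G.Adj i b))).1 fun s => by
    set T := s.biUnion fun i : ↥(K ∩ A) => (B \ K).filter (fun b => G.Adj i b)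
    set S := s.map (Function.Embedding.subtype _)
    have hSmem : ∀ z ∈ S, z ∈ K ∧ z ∈ A := fun z hz => by
      obtain ⟨i, -, rfl⟩ := Finset.mem_map.1 hz
      exact Finset.mem_inter.1 i.2
    have hcard := hmin ((K \ S) ∪ T) fun a ha b hb hab => by
      by_cases hbK : b ∈ K
      · have hbS : b ∉ S := fun hbS => Finset.disjoint_left.1 hAB (hSmem b hbS).2 hb
        exact Or.inr (Finset.mem_union_left _ (Finset.mem_sdiff.2 ⟨hbK, hbS⟩))
      · have haK : a ∈ K := (hcov a ha b hb hab).resolve_right hbK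
        by_cases haS : a ∈ S
        · obtain ⟨i, his, rfl⟩ := Finset.mem_map.1 haS
          refine Or.inr (Finset.mem_union_right _ (Finset.mem_biUnion.2 ⟨i, his, ?_⟩))
          exact Finset.mem_filter.2 ⟨Finset.mem_sdiff.2 ⟨hb, hbK⟩, hab⟩
        · exact Or.inl (Finset.mem_union_left _ (Finset.mem_sdiff.2 ⟨haK, haS⟩))
    have h1 := Finset.card_union_le (K \ S) T
    have h2 := Finset.card_sdiff_add_card_eq_card (fun z hz => (hSmem z hz).1 : S ⊆ K)
    have h3 : S.card = s.card := Finset.card_map _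
    omega
  refine ⟨g, hg, fun i => ?_⟩
  have := hgmem i
  simp only [Finset.mem_filter, Finset.mem_sdiff] at this
  exact ⟨this.1.1, this.1.2, this.2⟩

open Classical in
/-- Kőnig's theorem for the edges of `G` between two disjoint finite sets `A` and `B`: there is a
vertex cover `K` together with a matching of size `K.card`. -/
lemma exists_cover_matching {V : Type*} [Fintype V] (G : SimpleGraph V) {A B : Finset V}
    (hAB : Disjoint A B) :
    ∃ (K : Finset V) (p q : Fin K.card → V), p.Injective ∧ q.Injective ∧ (∀ i, p i ∈ A) ∧
      (∀ i, q i ∈ B) ∧ (∀ i, G.Adj (p i) (q i)) ∧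
      ∀ a ∈ A, ∀ b ∈ B, G.Adj a b → a ∈ K ∨ b ∈ K := by
  obtain ⟨K, hK, hmin⟩ := Finset.exists_min_image
    (Finset.univ.filter fun K : Finset V => ∀ a ∈ A, ∀ b ∈ B, G.Adj a b → a ∈ K ∨ b ∈ K)
    Finset.card ⟨A, by simp +contextual⟩
  simp only [Finset.mem_filter, Finset.mem_univ, true_and] at hK hmin
  have hKsub : K ∩ (A ∪ B) = K :=
    Finset.eq_of_subset_of_card_le Finset.inter_subset_left <| hmin _ fun a ha b hb hab => by
      have := hK a ha b hb hab
      simp only [Finset.mem_inter, Finset.mem_union]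
      tauto
  have hcard : (K ∩ A).card + (K ∩ B).card = K.card := by
    rw [← Finset.card_union_of_disjoint, ← Finset.inter_union_distrib_left, hKsub]
    exact hAB.mono Finset.inter_subset_right Finset.inter_subset_right
  obtain ⟨g, hg, hgmem⟩ := exists_injective_of_min_cover G hAB hK hmin
  obtain ⟨g', hg', hgmem'⟩ := exists_injective_of_min_cover G hAB.symm
    (fun b hb a ha hab => (hK a ha b hb hab.symm).symm)
    fun K' hK' => hmin K' fun a ha b hb hab => (hK' b hb a ha hab.symm).symm
  have e : Fin K.card ≃ ↥(K ∩ A) ⊕ ↥(K ∩ B) :=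
    (Fintype.equivFinOfCardEq (by
      rw [Fintype.card_sum, Fintype.card_coe, Fintype.card_coe, hcard])).symm
  have hKA : ∀ i : ↥(K ∩ A), ↑i ∈ K ∧ ↑i ∈ A := fun i => Finset.mem_inter.1 i.2
  have hKB : ∀ i : ↥(K ∩ B), ↑i ∈ K ∧ ↑i ∈ B := fun i => Finset.mem_inter.1 i.2
  refine ⟨K, Sum.elim (fun i : ↥(K ∩ A) => (i : V)) g' ∘ e,
    Sum.elim g (fun i : ↥(K ∩ B) => (i : V)) ∘ e, ?_, ?_, fun i => ?_,
    fun i => ?_, fun i => ?_, hK⟩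
  · refine (Subtype.val_injective.sumElim hg' fun i j hij => ?_).comp e.injective
    exact (hgmem' j).2.1 (hij ▸ (hKA i).1)
  · refine (hg.sumElim Subtype.val_injective fun i j hij => ?_).comp e.injective
    exact (hgmem i).2.1 (hij ▸ (hKB j).1)
  · rcases h : e i with j | j
    · simpa [h] using (hKA j).2
    · simpa [h] using (hgmem' j).1
  · rcases h : e i with j | j
    · simpa [h] using (hgmem j).1
    · simpa [h] using (hKB j).2
  · rcases h : e i with j | j
    · simpa [h] using (hgmem j).2.2
    · simpa [h] using (hgmem' j).2.2.symm

open Classical in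
/-- Either the Dirichlet form has a gap, or the edges between the leaf sets have a small cover. -/
lemma SpansDoubleStar.gap_or_exists_cover {V : Type*} [Fintype V] {G : SimpleGraph V}
    {x y : V} {C D : Finset V} (h : SpansDoubleStar G x y C D) :
    (∀ f : V → ℝ, f y = 0 → 2 * (1 / 10) * ∑ v, f v ^ 2 ≤ dirichletForm G f) ∨
    ∃ K : Finset V, 343 * K.card + 810 < 100 * C.card ∧
      ∀ a ∈ C, ∀ b ∈ D, G.Adj a b → a ∈ K ∨ b ∈ K := by
  obtain ⟨K, p, q, hp, hq, hpC, hqD, hadj, hcov⟩ := exists_cover_matching G h.disjoint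
  by_cases hK : 343 * K.card + 810 < 100 * C.card
  · exact Or.inr ⟨K, hK, hcov⟩
  refine Or.inl fun f hf => h.le_dirichletForm (ω := 1) (κ := 343 / 900) hp hq hpC hqD ?_ ?_ f hf ?_
  · intro t s ρ
    nlinarith [sq_nonneg (19 * s - 10 * t), sq_nonneg (261 * t - 190 * ρ), sq_nonneg ρ]
  · rw [Fintype.card_fin]
    have : (100 * C.card : ℝ) ≤ 343 * K.card + 810 := by exact_mod_cast not_lt.1 hK
    linarith
  · set e : V → V → ℝ := fun a b => if G.Adj a b then (f a - f b) ^ 2 else 0 with he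
    have hnonneg : ∀ a b, 0 ≤ e a b := fun a b => by simp only [he]; split_ifs <;> positivity
    have hsymm : ∀ a b, e a b = e b a := fun a b => by
      simp only [he, G.adj_comm a b, sub_sq_comm (f a)]
    have hCD : ∑ i, (f (p i) - f (q i)) ^ 2 ≤ ∑ a ∈ C, ∑ b ∈ D, e a b := by
      rw [← Finset.sum_product' C D e]
      have hinj : Function.Injective fun i => (p i, q i) := fun i j hij => hp (congrArg Prod.fst hij)
      have : ∑ i, (f (p i) - f (q i)) ^ 2 = ∑ i, e (p i) (q i) :=
        Finset.sum_congr rfl fun i _ => by simp only [he, hadj i, if_true]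
      rw [this, ← Finset.sum_image (f := fun z : V × V => e z.1 z.2) hinj.injOn]
      refine Finset.sum_le_sum_of_subset_of_nonneg ?_ fun z _ _ => hnonneg _ _
      intro z; simp only [Finset.mem_image]; rintro ⟨i, -, rfl⟩
      exact Finset.mem_product.2 ⟨hpC i, hqD i⟩
    have hDC : ∑ a ∈ D, ∑ b ∈ C, e a b = ∑ a ∈ C, ∑ b ∈ D, e a b := by
      rw [Finset.sum_comm]; simp only [hsymm]
    have hCC : 0 ≤ ∑ a ∈ C, ∑ b ∈ C, e a b :=
      Finset.sum_nonneg fun a _ => Finset.sum_nonneg fun b _ => hnonneg a b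
    have hDD : 0 ≤ ∑ a ∈ D, ∑ b ∈ D, e a b :=
      Finset.sum_nonneg fun a _ => Finset.sum_nonneg fun b _ => hnonneg a b
    simp only [Finset.sum_union h.disjoint, Finset.sum_add_distrib]
    linarith

open Classical in
/-- If a vertex `a` other than the centres is adjacent to many leaves on both sides of a spanning
double star, then the Dirichlet form has a gap. -/
lemma SpansDoubleStar.gap_of_common_neighbor {V : Type*} [Fintype V] {G : SimpleGraph V}
    {x y : V} {C D Z Z' : Finset V} (h : SpansDoubleStar G x y C D) (hZ : Z ⊆ C) (hZ' : Z' ⊆ D)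
    {a : V} (hax : a ≠ x) (hay : a ≠ y) (haZ : ∀ z ∈ Z, G.Adj a z) (haZ' : ∀ z ∈ Z', G.Adj a z)
    {k : ℕ} (hk : k ≤ Z.card) (hk' : k ≤ Z'.card) (hcard : 100 * C.card ≤ 262 * k + 810)
    (f : V → ℝ) (hf : f y = 0) : 2 * (1 / 10) * ∑ v, f v ^ 2 ≤ dirichletForm G f := by
  obtain ⟨P⟩ : Nonempty (Fin k ↪ Z) := Function.Embedding.nonempty_of_card_le (by simpa using hk)
  obtain ⟨Q⟩ : Nonempty (Fin k ↪ Z') := Function.Embedding.nonempty_of_card_le (by simpa using hk')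
  have hp : Function.Injective fun i => (P i : V) := Subtype.val_injective.comp P.injective
  have hq : Function.Injective fun i => (Q i : V) := Subtype.val_injective.comp Q.injective
  refine h.le_dirichletForm (ω := 1 / 2) (κ := 262 / 900) hp hq (fun i => hZ (P i).2)
    (fun i => hZ' (Q i).2) ?_ ?_ f hf ?_
  · intro t s ρ
    nlinarith [sq_nonneg (14 * s - 5 * t), sq_nonneg (342 * t - 280 * ρ), sq_nonneg ρ]
  · rw [Fintype.card_fin]
    have : (100 * C.card : ℝ) ≤ 262 * k + 810 := by exact_mod_cast hcard
    linarith
  · set e : V → V → ℝ := fun a b => if G.Adj a b then (f a - f b) ^ 2 else 0 with he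
    have hnonneg : ∀ a b, 0 ≤ e a b := fun a b => by simp only [he]; split_ifs <;> positivity
    have hsymm : ∀ a b, e a b = e b a := fun a b => by
      simp only [he, G.adj_comm a b, sub_sq_comm (f a)]
    have hdiag : ∀ a, e a a = 0 := fun a => by simp [he]
    have ha : a ∈ C ∪ D := by
      have := h.cover a
      rw [Finset.mem_union]; tauto
    rw [← Finset.insert_erase ha, sum_sum_insert_of_symm e hsymm hdiag (Finset.notMem_erase a _)]
    have hrest : 0 ≤ ∑ b ∈ (C ∪ D).erase a, ∑ c ∈ (C ∪ D).erase a, e b c :=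
      Finset.sum_nonneg fun b _ => Finset.sum_nonneg fun c _ => hnonneg b c
    have hrow : ∑ c ∈ (C ∪ D).erase a, e a c = ∑ c ∈ C, e a c + ∑ c ∈ D, e a c := by
      rw [← Finset.sum_union h.disjoint, Finset.sum_erase _ (hdiag a)]
    have hstar : ∀ {g : Fin k → V} {S T : Finset V}, g.Injective → (∀ i, g i ∈ S) → S ⊆ T →
        (∀ z ∈ S, G.Adj a z) → ∑ i, (f a - f (g i)) ^ 2 ≤ ∑ c ∈ T, e a c := by
      intro g S T hg hgS hST hadj
      have : ∑ i, (f a - f (g i)) ^ 2 = ∑ i, e a (g i) :=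
        Finset.sum_congr rfl fun i _ => by simp only [he, hadj _ (hgS i), if_true]
      rw [this, ← Finset.sum_image (f := fun z => e a z) hg.injOn]
      refine Finset.sum_le_sum_of_subset_of_nonneg ?_ fun z _ _ => hnonneg _ _
      intro z; simp only [Finset.mem_image]; rintro ⟨i, -, rfl⟩
      exact hST (hgS i)
    have hP := hstar hp (fun i => (P i).2) hZ haZ
    have hQ := hstar hq (fun i => (Q i).2) hZ' haZ'
    have htri : ∑ i, (f (P i) - f (Q i)) ^ 2 ≤
        2 * (∑ i, (f a - f (P i)) ^ 2 + ∑ i, (f a - f (Q i)) ^ 2) := by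
      rw [← Finset.sum_add_distrib, Finset.mul_sum]
      refine Finset.sum_le_sum fun i _ => ?_
      nlinarith [sq_nonneg (2 * f a - f (P i) - f (Q i))]
    linarith

open Classical in
lemma card_le_of_subset_union {V : Type*} {S K K' : Finset V} {u v : V} (T : Finset V)
    (h : ∀ z ∈ S, z = u ∨ z = v ∨ z ∈ K ∨ z ∈ K' ∨ z ∈ T) :
    S.card ≤ K.card + K'.card + T.card + 2 := by
  have hsub : S ⊆ insert u (insert v (K ∪ K' ∪ T)) := fun z hz => by
    have := h z hz
    simp only [Finset.mem_insert, Finset.mem_union]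
    tauto
  have h1 := Finset.card_le_card hsub
  have h2 := Finset.card_insert_le u (insert v (K ∪ K' ∪ T))
  have h3 := Finset.card_insert_le v (K ∪ K' ∪ T)
  have h4 := Finset.card_union_le (K ∪ K') T
  have h5 := Finset.card_union_le K K'
  omega

open Classical in
/-- If the covers `K`, `K'` and the centres of the double star of `Gᶜ` contain the whole leaf set `S`
of the double star of `G`, then the Dirichlet form of `Gᶜ` has a gap. -/
lemma SpansDoubleStar.gap_of_subset_covers {V : Type*} [Fintype V] {G : SimpleGraph V}
    {u v x y : V} {S T C D K K' : Finset V} (h : SpansDoubleStar G u v S T)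
    (h' : SpansDoubleStar Gᶜ x y C D) (hCD : C.card ≤ D.card) (hSC : K.card + 2 < S.card)
    (hK : 343 * K.card + 810 < 100 * C.card) (hK' : 343 * K'.card + 810 < 100 * C.card)
    (hcov : ∀ a ∈ S, ∀ b ∈ T, G.Adj a b → a ∈ K ∨ b ∈ K)
    (hS : ∀ z ∈ S, z = x ∨ z = y ∨ z ∈ K ∨ z ∈ K')
    (f : V → ℝ) (hf : f y = 0) : 2 * (1 / 10) * ∑ v, f v ^ 2 ≤ dirichletForm Gᶜ f := by
  obtain ⟨a, haS, hax, hay, haK⟩ : ∃ a ∈ S, a ≠ x ∧ a ≠ y ∧ a ∉ K := by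
    by_contra! hcon
    have := card_le_of_subset_union (S := S) (K := K) (K' := ∅) (u := x) (v := y) ∅ fun z hz => by
      have := hcon z hz
      tauto
    simp only [Finset.card_empty] at this
    omega
  have hadj : ∀ z ∈ T \ K, Gᶜ.Adj a z := fun z hz => by
    obtain ⟨hzT, hzK⟩ := Finset.mem_sdiff.1 hz
    rw [SimpleGraph.compl_adj]
    refine ⟨fun haz => Finset.disjoint_left.1 h.disjoint haS (haz ▸ hzT), fun haz => ?_⟩
    exact (hcov a haS z hzT haz).elim haK hzK
  have hlarge : ∀ E : Finset V, x ∉ E → y ∉ E →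
      E.card ≤ K.card + K'.card + (E ∩ (T \ K)).card + 2 := fun E hx hy =>
    card_le_of_subset_union (u := u) (v := v) _ fun z hz => by
      have hzx : z ≠ x := fun hzx => hx (hzx ▸ hz)
      have hzy : z ≠ y := fun hzy => hy (hzy ▸ hz)
      have h1 := h.cover z
      have h2 := hS z
      simp only [Finset.mem_inter, Finset.mem_sdiff]
      tauto
  have hx := h'.left_notMem
  have hy := h'.right_notMem
  simp only [Finset.mem_union, not_or] at hx hy
  have hC := hlarge C hx.1 hy.1
  have hD := hlarge D hx.2 hy.2
  exact h'.gap_of_common_neighbor (k := C.card - (K.card + K'.card + 2)) Finset.inter_subset_left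
    Finset.inter_subset_left hax hay (fun z hz => hadj z (Finset.mem_inter.1 hz).2)
    (fun z hz => hadj z (Finset.mem_inter.1 hz).2) (by omega) (by omega) (by omega) f hf

open Classical in
/-- If `G` and its complement both have a spanning double star, one of the two Dirichlet forms has
a gap. -/
lemma SpansDoubleStar.gap_or_gap_compl {V : Type*} [Fintype V] {G : SimpleGraph V}
    {u v x y : V} {A B C D : Finset V} (h : SpansDoubleStar G u v A B)
    (h' : SpansDoubleStar Gᶜ x y C D) (hAB : A.card ≤ B.card) (hCD : C.card ≤ D.card)
    (hAC : A.card ≤ C.card) :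
    (∀ f : V → ℝ, f v = 0 → 2 * (1 / 10) * ∑ v, f v ^ 2 ≤ dirichletForm G f) ∨
    (∀ f : V → ℝ, f y = 0 → 2 * (1 / 10) * ∑ v, f v ^ 2 ≤ dirichletForm Gᶜ f) := by
  obtain hgap | ⟨K, hK, hcov⟩ := h.gap_or_exists_cover
  · exact Or.inl hgap
  obtain hgap | ⟨K', hK', hcov'⟩ := h'.gap_or_exists_cover
  · exact Or.inr hgap
  refine Or.inr ?_
  by_cases hA : ∀ z ∈ A, z = x ∨ z = y ∨ z ∈ K ∨ z ∈ K'
  · exact h.gap_of_subset_covers h' hCD (by omega) (by omega) hK' hcov hA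
  by_cases hB : ∀ z ∈ B, z = x ∨ z = y ∨ z ∈ K ∨ z ∈ K'
  · exact h.symm.gap_of_subset_covers h' hCD (by omega) (by omega) hK'
      (fun b hb a ha hab => (hcov a ha b hb hab.symm).symm) hB
  exfalso
  have hlarge : ∀ E : Finset V, C.card ≤ E.card →
      ∃ z ∈ E, z ≠ u ∧ z ≠ v ∧ z ∉ K ∧ z ∉ K' := fun E hE => by
    by_contra! hcon
    have := card_le_of_subset_union (S := E) (K := K) (K' := K') (u := u) (v := v) ∅ fun z hz => by
      have := hcon z hz
      tauto
    simp only [Finset.card_empty] at this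
    omega
  obtain ⟨c, hcC, hcu, hcv, hcK, hcK'⟩ := hlarge C le_rfl
  obtain ⟨d, hdD, hdu, hdv, hdK, hdK'⟩ := hlarge D hCD
  push Not at hA hB
  obtain ⟨a, haA, hax, hay, haK, haK'⟩ := hA
  obtain ⟨b, hbB, hbx, hby, hbK, hbK'⟩ := hB
  have hnAB : ∀ a ∈ A, ∀ b ∈ B, a ∉ K → b ∉ K → ¬ G.Adj a b := fun a ha b hb haK hbK hab =>
    (hcov a ha b hb hab).elim haK hbK
  have hCDadj : ∀ c ∈ C, ∀ d ∈ D, c ∉ K' → d ∉ K' → G.Adj c d := fun c hc d hd hcK hdK => by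
    by_contra hcd
    refine (hcov' c hc d hd ?_).elim hcK hdK
    rw [SimpleGraph.compl_adj]
    exact ⟨fun heq => Finset.disjoint_left.1 h'.disjoint hc (heq ▸ hd), hcd⟩
  have hside : ∀ a ∈ A, ∀ b ∈ B, a ∉ K → b ∉ K → a ∉ K' → b ∉ K' →
      ¬ (a ∈ C ∧ b ∈ D) ∧ ¬ (a ∈ D ∧ b ∈ C) := fun a ha b hb haK hbK haK' hbK' =>
    ⟨fun hab => hnAB a ha b hb haK hbK (hCDadj a hab.1 b hab.2 haK' hbK'),
      fun hab => hnAB a ha b hb haK hbK (hCDadj b hab.2 a hab.1 hbK' haK').symm⟩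
  have ha : a ∈ C ∨ a ∈ D := by simpa [hax, hay] using h'.cover a
  have hb : b ∈ C ∨ b ∈ D := by simpa [hbx, hby] using h'.cover b
  have hc : c ∈ A ∨ c ∈ B := by simpa [hcu, hcv] using h.cover c
  have hd : d ∈ A ∨ d ∈ B := by simpa [hdu, hdv] using h.cover d
  have hab := hside a haA b hbB haK hbK haK' hbK'
  rcases ha with ha | ha
  · have hbC : b ∈ C := hb.resolve_right fun hb => hab.1 ⟨ha, hb⟩
    rcases hd with hd | hd
    · exact (hside d hd b hbB hdK hbK hdK' hbK').2 ⟨hdD, hbC⟩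
    · exact (hside a haA d hd haK hdK haK' hdK').1 ⟨ha, hdD⟩
  · have hbD : b ∈ D := hb.resolve_left fun hb => hab.2 ⟨ha, hb⟩
    rcases hc with hc | hc
    · exact (hside c hc b hbB hcK hbK hcK' hbK').1 ⟨hcC, hbD⟩
    · exact (hside a haA c hc haK hcK haK' hcK').2 ⟨ha, hcC⟩

open Classical in
/-- Two vertices at distance three dominate the complement. -/
lemma exists_spansDoubleStar_compl {V : Type*} [Fintype V] {G : SimpleGraph V}
    (hdiam : G.diam = 3) : ∃ (x y : V) (C D : Finset V),
      SpansDoubleStar Gᶜ x y C D ∧ C.card ≤ D.card := by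
  have : Nonempty V := by
    by_contra hV
    have := not_nonempty_iff.1 hV
    have := (SimpleGraph.diam_eq_zero (G := G)).2 (Or.inr inferInstance)
    omega
  obtain ⟨x, y, hxy⟩ := G.exists_dist_eq_diam
  rw [hdiam] at hxy
  have hne : x ≠ y := by rintro rfl; simp at hxy
  have hnadj : ¬ G.Adj x y := fun h => by
    have := SimpleGraph.dist_eq_one_iff_adj.2 h
    omega
  have hncommon : ∀ z, ¬ (G.Adj x z ∧ G.Adj y z) := fun z hz => by
    have := SimpleGraph.dist_le (SimpleGraph.Walk.cons hz.1 (SimpleGraph.Walk.cons hz.2.symm .nil))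
    simp at this
    omega
  have hstar : SpansDoubleStar Gᶜ x y (Finset.univ.filter fun z => z ≠ y ∧ Gᶜ.Adj x z)
      (Finset.univ.filter fun z => z ≠ x ∧ z ≠ y ∧ ¬ Gᶜ.Adj x z) := by
    constructor
    · simp [hne, hnadj]
    · simp
    · intro z
      have := hncommon z
      simp only [Finset.mem_filter, Finset.mem_univ, true_and, SimpleGraph.compl_adj, ne_eq,
        eq_comm (b := z)]
      tauto
    · rw [Finset.disjoint_left]
      intro z
      simp only [Finset.mem_filter, Finset.mem_univ, true_and]
      tauto
    · simp
    · simp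
    · intro z
      simp only [Finset.mem_filter, Finset.mem_univ, true_and]
      tauto
  rcases le_total (Finset.univ.filter fun z => z ≠ y ∧ Gᶜ.Adj x z).card
    (Finset.univ.filter fun z => z ≠ x ∧ z ≠ y ∧ ¬ Gᶜ.Adj x z).card with hle | hle
  · exact ⟨x, y, _, _, hstar, hle⟩
  · exact ⟨y, x, _, _, hstar.symm, hle⟩

/-- **Proposition 4.3.** If `G` and `Ḡ` are both connected with diameter exactly `3`,
then `max(Gap(G), Gap(Ḡ)) ≥ ((3 - √5)/8) · (1/(n-1))`. -/
theorem max_gap_self_compl_of_diam_three {V : Type*} [Fintype V] (G : SimpleGraph V)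
    (hconn : G.Connected) (hconn' : Gᶜ.Connected)
    (hdiam : G.diam = 3) (hdiam' : Gᶜ.diam = 3) :
    (3 - Real.sqrt 5) / 8 * (1 / ((Fintype.card V : ℝ) - 1)) ≤
      max (spectralGap G) (spectralGap Gᶜ) := by
  classical
  obtain ⟨u, v, A, B, h, hAB⟩ := exists_spansDoubleStar_compl hdiam'
  obtain ⟨x, y, C, D, h', hCD⟩ := exists_spansDoubleStar_compl hdiam
  rw [compl_compl] at h
  have : Nontrivial V := ⟨u, v, h.adj.ne⟩
  have hgap : (∃ w, ∀ f : V → ℝ, f w = 0 → 2 * (1 / 10) * ∑ v, f v ^ 2 ≤ dirichletForm G f) ∨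
      (∃ w, ∀ f : V → ℝ, f w = 0 → 2 * (1 / 10) * ∑ v, f v ^ 2 ≤ dirichletForm Gᶜ f) := by
    rcases le_total A.card C.card with hAC | hAC
    · exact (h.gap_or_gap_compl h' hAB hCD hAC).imp (fun h => ⟨v, h⟩) fun h => ⟨y, h⟩
    · have h'' : SpansDoubleStar Gᶜᶜ u v A B := by rwa [compl_compl]
      have := h'.gap_or_gap_compl h'' hCD hAB hAC
      rw [compl_compl] at this
      exact this.symm.imp (fun h => ⟨v, h⟩) fun h => ⟨y, h⟩
  have hnpos : (0 : ℝ) < (Fintype.card V : ℝ) - 1 := by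
    have : (2 : ℝ) ≤ Fintype.card V := by
      exact_mod_cast Fintype.one_lt_card (α := V)
    linarith
  have hconst : (3 - Real.sqrt 5) / 8 * (1 / ((Fintype.card V : ℝ) - 1)) ≤
      1 / 10 * (1 / ((Fintype.card V : ℝ) - 1)) := by
    refine mul_le_mul_of_nonneg_right ?_ (by positivity)
    have : (2.2 : ℝ) ≤ Real.sqrt 5 := Real.le_sqrt_of_sq_le (by norm_num)
    linarith
  refine hconst.trans (le_max_iff.2 (hgap.imp ?_ ?_)) <;> rintro ⟨w, hw⟩
  · exact le_spectralGap_of_le_dirichletForm G hconn w _ (by norm_num) hw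
  · exact le_spectralGap_of_le_dirichletForm Gᶜ hconn' w _ (by norm_num) hw
end
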